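/- arXiv:1202.4124 — 2 statements merged into one kernel-verified Lean document; each statement's English description precedes it below -/
import Mathlib

section
/- Pointwise Hessian bound: there is an absolute constant c such that for every measurable f: R^n → [0,1], every t > 0, and every x ∈ R^n, the function h_t = Φ^{-1}(P_t f) satisfies ||H(h_t)(x)||_F ≤ c · (e^{-2t}/(1 - e^{-2t})) · sqrt(log(1/(f_t(x)(1 - f_t(x))))), where f_t = P_t f and H denotes the Hessian. -/
open MeasureTheory Real Filter
open scoped ENNReal NNReal

noncomputable def stdGaussian (n : ℕ) : Measure (Fin n → ℝ) :=
  Measure.pi fun _ => ProbabilityTheory.gaussianReal 0 1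

noncomputable def gaussPhi (x : ℝ) : ℝ := (Real.sqrt (2 * Real.pi))⁻¹ * Real.exp (-(x ^ 2) / 2)

noncomputable def gaussCdf (x : ℝ) : ℝ := ∫ y in Set.Iic x, gaussPhi y

noncomputable def gaussCdfInv : ℝ → ℝ := Function.invFun gaussCdf

/-- The Gaussian isoperimetric function `I = φ ∘ Φ⁻¹`, extended by `I(0) = I(1) = 0`. -/
noncomputable def isoI (a : ℝ) : ℝ := if a ≤ 0 ∨ 1 ≤ a then 0 else gaussPhi (gaussCdfInv a)

/-- Ornstein-Uhlenbeck semigroup. -/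
noncomputable def OU (n : ℕ) (t : ℝ) (f : (Fin n → ℝ) → ℝ) (x : Fin n → ℝ) : ℝ :=
  ∫ y, f (fun i => Real.exp (-t) * x i + Real.sqrt (1 - Real.exp (-2 * t)) * y i) ∂(stdGaussian n)

/-- Partial derivative in direction `i`. -/
noncomputable def pd {n : ℕ} (i : Fin n) (f : (Fin n → ℝ) → ℝ) (x : Fin n → ℝ) : ℝ :=
  fderiv ℝ f x (Pi.single i 1)

/-- Second partial derivative. -/
noncomputable def pd2 {n : ℕ} (i j : Fin n) (f : (Fin n → ℝ) → ℝ) (x : Fin n → ℝ) : ℝ :=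
  pd j (pd i f) x

/-- Euclidean norm of the gradient. -/
noncomputable def gradNorm {n : ℕ} (f : (Fin n → ℝ) → ℝ) (x : Fin n → ℝ) : ℝ :=
  Real.sqrt (∑ i, (pd i f x) ^ 2)

/-- Frobenius norm of the Hessian. -/
noncomputable def hessFrob {n : ℕ} (f : (Fin n → ℝ) → ℝ) (x : Fin n → ℝ) : ℝ :=
  Real.sqrt (∑ i, ∑ j, (pd2 i j f x) ^ 2)

noncomputable def frob {n : ℕ} (A : Matrix (Fin n) (Fin n) ℝ) : ℝ :=
  Real.sqrt (∑ i, ∑ j, (A i j) ^ 2)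

/-- One-dimensional Hermite polynomial (physicists'/probabilists' unnormalized, as in the paper). -/
noncomputable def hermite1 (k : ℕ) (x : ℝ) : ℝ :=
  Real.exp (x ^ 2 / 2) * iteratedDeriv k (fun y => Real.exp (-(y ^ 2) / 2)) x

/-- Multi-dimensional Hermite polynomial. -/
noncomputable def hermiteM {n : ℕ} (α : Fin n → ℕ) (x : Fin n → ℝ) : ℝ :=
  ∏ i, hermite1 (α i) (x i)

/-- Orthonormal Hermite polynomial. -/
noncomputable def hermiteG {n : ℕ} (α : Fin n → ℕ) (x : Fin n → ℝ) : ℝ :=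
  hermiteM α x / Real.sqrt (∏ i, Nat.factorial (α i))

/-- `M` is a median of `f` under `μ`. -/
def IsMedian {Ω : Type*} [MeasurableSpace Ω] (μ : Measure Ω) (f : Ω → ℝ) (M : ℝ) : Prop :=
  (1 : ℝ≥0∞) / 2 ≤ μ {x | f x ≤ M} ∧ (1 : ℝ≥0∞) / 2 ≤ μ {x | M ≤ f x}

/-- Gaussian boundary measure (perimeter), via smooth vector fields all of whose
derivatives vanish at infinity. -/
noncomputable def gaussBoundary (n : ℕ) (A : Set (Fin n → ℝ)) : ℝ :=
  sSup { r : ℝ | ∃ v : (Fin n → ℝ) → (Fin n → ℝ),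
    ContDiff ℝ (⊤ : ℕ∞) v ∧
    (∀ k : ℕ, Tendsto (fun x => ‖iteratedFDeriv ℝ k v x‖) (cocompact _) (nhds 0)) ∧
    (∀ x, Real.sqrt (∑ i, (v x i) ^ 2) ≤ 1) ∧
    r = ∫ x in A, (∑ i, (pd i (fun y => v y i) x - x i * v x i)) ∂(stdGaussian n) }

lemma gaussPhi_eq_gaussianPDFReal : gaussPhi = ProbabilityTheory.gaussianPDFReal 0 1 := by
  ext x
  simp [gaussPhi, ProbabilityTheory.gaussianPDFReal]

lemma gaussPhi_pos (x : ℝ) : 0 < gaussPhi x := by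
  unfold gaussPhi; positivity

lemma continuous_gaussPhi : Continuous gaussPhi := by
  unfold gaussPhi; fun_prop

lemma gaussPhi_neg (x : ℝ) : gaussPhi (-x) = gaussPhi x := by
  simp [gaussPhi]

lemma integrable_gaussPhi : Integrable gaussPhi := by
  rw [gaussPhi_eq_gaussianPDFReal]
  exact ProbabilityTheory.integrable_gaussianPDFReal 0 1

lemma integral_gaussPhi : ∫ x, gaussPhi x = 1 := by
  rw [gaussPhi_eq_gaussianPDFReal]
  exact ProbabilityTheory.integral_gaussianPDFReal_eq_one 0 one_ne_zero

lemma hasDerivAt_gaussPhi (x : ℝ) : HasDerivAt gaussPhi (-x * gaussPhi x) x := by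
  have h : HasDerivAt (fun x : ℝ => -(x ^ 2) / 2) (-x) x :=
    ((hasDerivAt_pow 2 x).neg.div_const 2).congr_deriv (by norm_num; ring)
  refine (h.exp.const_mul (Real.sqrt (2 * Real.pi))⁻¹).congr_deriv ?_
  simp only [gaussPhi]
  ring

lemma gaussCdf_eq_measureReal (x : ℝ) :
    gaussCdf x = (ProbabilityTheory.gaussianReal 0 1).real (Set.Iic x) := by
  rw [measureReal_def, ProbabilityTheory.gaussianReal_apply_eq_integral 0 one_ne_zero,
    ENNReal.toReal_ofReal, gaussCdf, gaussPhi_eq_gaussianPDFReal]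
  exact setIntegral_nonneg measurableSet_Iic
    fun y _ => ProbabilityTheory.gaussianPDFReal_nonneg 0 1 y

lemma gaussCdf_eq_cdf :
    gaussCdf = ProbabilityTheory.cdf (ProbabilityTheory.gaussianReal 0 1) := by
  ext x
  rw [gaussCdf_eq_measureReal, ProbabilityTheory.cdf_eq_real]

lemma hasDerivAt_gaussCdf (x : ℝ) : HasDerivAt gaussCdf (gaussPhi x) x := by
  have h : gaussCdf = fun x => gaussCdf 0 + ∫ y in (0 : ℝ)..x, gaussPhi y := by
    ext x
    have := intervalIntegral.integral_Iic_sub_Iic (μ := volume) (f := gaussPhi) (a := 0) (b := x)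
      integrable_gaussPhi.integrableOn integrable_gaussPhi.integrableOn
    unfold gaussCdf
    linarith
  rw [h]
  refine HasDerivAt.const_add _ ?_
  exact continuous_gaussPhi.integral_hasStrictDerivAt 0 x |>.hasDerivAt

lemma strictMono_gaussCdf : StrictMono gaussCdf :=
  strictMono_of_hasDerivAt_pos hasDerivAt_gaussCdf gaussPhi_pos

lemma gaussCdf_neg (x : ℝ) : gaussCdf (-x) = 1 - gaussCdf x := by
  have h1 : gaussCdf (-x) = ∫ y in Set.Ioi x, gaussPhi y := by
    rw [gaussCdf, ← integral_comp_neg_Ioi]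
    simp [gaussPhi_neg]
  have h2 := integral_add_compl (μ := volume) (measurableSet_Iic (a := x)) integrable_gaussPhi
  rw [integral_gaussPhi, Set.compl_Iic] at h2
  rw [h1, gaussCdf]
  linarith

lemma exists_gaussCdf_eq {a : ℝ} (h0 : 0 < a) (h1 : a < 1) : ∃ q, gaussCdf q = a := by
  have hc : Continuous gaussCdf :=
    continuous_iff_continuousAt.2 fun x => (hasDerivAt_gaussCdf x).continuousAt
  have hbot : Tendsto gaussCdf atBot (nhds 0) := by
    rw [gaussCdf_eq_cdf]; exact ProbabilityTheory.tendsto_cdf_atBot _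
  have htop : Tendsto gaussCdf atTop (nhds 1) := by
    rw [gaussCdf_eq_cdf]; exact ProbabilityTheory.tendsto_cdf_atTop _
  obtain ⟨x, hx⟩ := (hbot.eventually (gt_mem_nhds h0)).exists
  obtain ⟨y, hy⟩ := (htop.eventually (lt_mem_nhds h1)).exists
  exact mem_range_of_exists_le_of_exists_ge hc ⟨x, hx.le⟩ ⟨y, hy.le⟩

lemma gaussCdfInv_gaussCdf (q : ℝ) : gaussCdfInv (gaussCdf q) = q :=
  Function.leftInverse_invFun strictMono_gaussCdf.injective q

lemma hasDerivAt_gaussCdfInv {a : ℝ} (h0 : 0 < a) (h1 : a < 1) :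
    HasDerivAt gaussCdfInv (gaussPhi (gaussCdfInv a))⁻¹ a := by
  obtain ⟨q, rfl⟩ := exists_gaussCdf_eq h0 h1
  rw [gaussCdfInv_gaussCdf]
  have h : HasStrictDerivAt gaussCdf (gaussPhi q) q :=
    hasStrictDerivAt_of_hasDerivAt_of_continuousAt (Eventually.of_forall hasDerivAt_gaussCdf)
      continuous_gaussPhi.continuousAt
  exact (h.to_local_left_inverse (gaussPhi_pos q).ne'
    (Eventually.of_forall gaussCdfInv_gaussCdf)).hasDerivAt

lemma gaussCdf_zero : gaussCdf 0 = 1 / 2 := by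
  have := gaussCdf_neg 0
  rw [neg_zero] at this
  linarith

lemma sqrt_two_pi_le : Real.sqrt (2 * Real.pi) ≤ 2.7 := by
  rw [Real.sqrt_le_left (by norm_num)]
  have := Real.pi_lt_d2
  norm_num
  linarith

lemma gaussCdf_le_exp {q : ℝ} (hq : q ≤ 0) : gaussCdf q ≤ Real.exp (-(q ^ 2) / 2) := by
  have h := ProbabilityTheory.measure_le_le_exp_mul_mgf (μ := ProbabilityTheory.gaussianReal 0 1)
    (X := id) q hq (ProbabilityTheory.integrable_exp_mul_gaussianReal q)
  rw [ProbabilityTheory.mgf_id_gaussianReal, ← Real.exp_add] at h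
  rw [gaussCdf_eq_measureReal]
  refine h.trans (Real.exp_le_exp.2 ?_)
  simp
  nlinarith

lemma neg_mul_gaussCdf_le (q : ℝ) : -q * gaussCdf q ≤ gaussPhi q := by
  have h_int : Integrable (fun y : ℝ => -y * gaussPhi y) := by
    have := (integrable_mul_exp_neg_mul_sq (b := 1 / 2) (by norm_num)).const_mul
      (-(Real.sqrt (2 * Real.pi))⁻¹)
    refine this.congr (Eventually.of_forall fun y => ?_)
    have : -(1 / 2) * y ^ 2 = -(y ^ 2) / 2 := by ring
    simp only [gaussPhi, this]
    ring
  have h0 : Tendsto gaussPhi atBot (nhds 0) :=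
    tendsto_zero_of_hasDerivAt_of_integrableOn_Iic (a := 0) (fun x _ => hasDerivAt_gaussPhi x)
      h_int.integrableOn integrable_gaussPhi.integrableOn
  have h := integral_Iic_of_hasDerivAt_of_tendsto' (a := q) (fun x _ => hasDerivAt_gaussPhi x)
    h_int.integrableOn h0
  rw [sub_zero] at h
  rw [← h, gaussCdf, ← integral_const_mul]
  refine setIntegral_mono_on (integrable_gaussPhi.integrableOn.const_mul _) h_int.integrableOn
    measurableSet_Iic fun y hy => ?_
  have : y ≤ q := hy
  exact mul_le_mul_of_nonneg_right (by linarith) (gaussPhi_pos y).le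

lemma gaussPhi_sub_one_le_gaussCdf {q : ℝ} (hq : q ≤ 0) : gaussPhi (q - 1) ≤ gaussCdf q := by
  obtain ⟨z, hz, h⟩ := exists_hasDerivAt_eq_slope gaussCdf gaussPhi (show q - 1 < q by linarith)
    (fun x _ => (hasDerivAt_gaussCdf x).continuousAt.continuousWithinAt)
    (fun x _ => hasDerivAt_gaussCdf x)
  rw [sub_sub_cancel, div_one] at h
  have h0 : 0 ≤ gaussCdf (q - 1) := by
    rw [gaussCdf_eq_cdf]; exact ProbabilityTheory.cdf_nonneg _ _
  have h1 : gaussPhi (q - 1) ≤ gaussPhi z := by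
    unfold gaussPhi
    gcongr ?_ * Real.exp ?_
    nlinarith [hz.1, hz.2]
  linarith

/-- Comparison of the lower Gaussian tail `a = Φ(q)`, its logarithm and the density `φ(q)`. -/
lemma gaussCdf_tail_bounds {q : ℝ} (hq : q ≤ 0) :
    1 / 2 ≤ Real.log (1 / gaussCdf q) ∧ q ^ 2 ≤ 2 * Real.log (1 / gaussCdf q) ∧
      gaussCdf q ^ 2 * Real.log (1 / gaussCdf q) ≤ 32 * gaussPhi q ^ 2 := by
  have ha : 0 < gaussCdf q := (gaussPhi_pos _).trans_le (gaussPhi_sub_one_le_gaussCdf hq)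
  have hs := sqrt_two_pi_le
  have hs0 : 0 < Real.sqrt (2 * Real.pi) := by positivity
  have hle : gaussCdf q ≤ 2.7 * gaussPhi q := by
    refine (gaussCdf_le_exp hq).trans ?_
    have : Real.exp (-(q ^ 2) / 2) = Real.sqrt (2 * Real.pi) * gaussPhi q := by
      unfold gaussPhi; field_simp
    rw [this]
    exact mul_le_mul_of_nonneg_right hs (gaussPhi_pos q).le
  have h4 : gaussCdf q * (1 - q) ≤ 4 * gaussPhi q := by
    have := neg_mul_gaussCdf_le q
    have := gaussPhi_pos q
    nlinarith
  have hlog : Real.log (1 / gaussCdf q) ≤ 2 * (1 - q) ^ 2 := by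
    have h := Real.log_le_log (gaussPhi_pos _) (gaussPhi_sub_one_le_gaussCdf hq)
    have he : Real.log (gaussPhi (q - 1)) = -Real.log (Real.sqrt (2 * Real.pi)) - (q - 1) ^ 2 / 2 := by
      unfold gaussPhi
      rw [Real.log_mul (by positivity) (by positivity), Real.log_inv, Real.log_exp]
      ring
    have h1 : Real.log (Real.sqrt (2 * Real.pi)) ≤ 1 := by
      rw [Real.log_le_iff_le_exp hs0]
      have := Real.exp_one_gt_d9
      linarith
    rw [one_div, Real.log_inv]
    nlinarith
  refine ⟨?_, ?_, ?_⟩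
  · have h2 : gaussCdf q ≤ 1 / 2 := gaussCdf_zero ▸ strictMono_gaussCdf.monotone hq
    have h3 := Real.log_le_log ha h2
    rw [one_div (2 : ℝ), Real.log_inv] at h3
    have := Real.log_two_gt_d9
    rw [one_div (gaussCdf q), Real.log_inv]
    linarith
  · have h := Real.log_le_log ha (gaussCdf_le_exp hq)
    rw [Real.log_exp] at h
    rw [one_div, Real.log_inv]
    linarith
  · have h5 : 0 ≤ gaussCdf q * (1 - q) := mul_nonneg ha.le (by linarith)
    calc gaussCdf q ^ 2 * Real.log (1 / gaussCdf q) ≤ gaussCdf q ^ 2 * (2 * (1 - q) ^ 2) := by gcongr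
      _ = 2 * (gaussCdf q * (1 - q)) ^ 2 := by ring
      _ ≤ 2 * (4 * gaussPhi q) ^ 2 := by gcongr
      _ = 32 * gaussPhi q ^ 2 := by ring

instance isProbabilityMeasure_stdGaussian (n : ℕ) : IsProbabilityMeasure (stdGaussian n) := by
  unfold stdGaussian; infer_instance

/-- The density of the standard Gaussian measure translated by `b`, relative to the standard one. -/
noncomputable def shiftDensity {n : ℕ} (b y : Fin n → ℝ) : ℝ :=
  ∏ i, Real.exp (b i * y i - b i ^ 2 / 2)

lemma shiftDensity_eq_exp {n : ℕ} (b y : Fin n → ℝ) :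
    shiftDensity b y = Real.exp (∑ i, (b i * y i - b i ^ 2 / 2)) :=
  (Real.exp_sum _ _).symm

lemma shiftDensity_pos {n : ℕ} (b y : Fin n → ℝ) : 0 < shiftDensity b y := by
  rw [shiftDensity_eq_exp]; positivity

lemma measurable_shiftDensity {n : ℕ} (b : Fin n → ℝ) : Measurable (shiftDensity b) := by
  unfold shiftDensity; fun_prop

lemma gaussianReal_withDensity_exp (m : ℝ) :
    (ProbabilityTheory.gaussianReal 0 1).withDensity
        (fun y => ENNReal.ofReal (Real.exp (m * y - m ^ 2 / 2))) =
      ProbabilityTheory.gaussianReal m 1 := by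
  rw [ProbabilityTheory.gaussianReal_of_var_ne_zero _ one_ne_zero,
    ProbabilityTheory.gaussianReal_of_var_ne_zero _ one_ne_zero,
    ← withDensity_mul _ (by fun_prop) (by fun_prop)]
  congr 1
  ext y
  simp only [Pi.mul_apply, ProbabilityTheory.gaussianPDF]
  rw [← ENNReal.ofReal_mul (ProbabilityTheory.gaussianPDFReal_nonneg _ _ _)]
  congr 1
  simp only [ProbabilityTheory.gaussianPDFReal, mul_assoc, ← Real.exp_add]
  congr 3
  simp
  ring

lemma stdGaussian_withDensity_shiftDensity {n : ℕ} (b : Fin n → ℝ) :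
    (stdGaussian n).withDensity (fun y => ENNReal.ofReal (shiftDensity b y)) =
      Measure.pi fun i => ProbabilityTheory.gaussianReal (b i) 1 := by
  refine (Measure.pi_eq fun s hs => ?_).symm
  have hind : ProbabilityTheory.iIndepFun
      (fun i (y : Fin n → ℝ) => (s i).indicator
        (fun z => ENNReal.ofReal (Real.exp (b i * z - b i ^ 2 / 2))) (y i)) (stdGaussian n) :=
    ProbabilityTheory.iIndepFun_pi (X := fun i => (s i).indicator
      (fun z => ENNReal.ofReal (Real.exp (b i * z - b i ^ 2 / 2))))
      fun i => (Measurable.indicator (by fun_prop) (hs i)).aemeasurable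
  have hm : ∀ i, Measurable ((s i).indicator
      (fun z => ENNReal.ofReal (Real.exp (b i * z - b i ^ 2 / 2)))) :=
    fun i => Measurable.indicator (by fun_prop) (hs i)
  rw [withDensity_apply _ (MeasurableSet.univ_pi hs),
    ← lintegral_indicator (MeasurableSet.univ_pi hs)]
  have heq : (Set.univ.pi s).indicator (fun y => ENNReal.ofReal (shiftDensity b y)) =
      fun y => ∏ i, (s i).indicator
        (fun z => ENNReal.ofReal (Real.exp (b i * z - b i ^ 2 / 2))) (y i) := by
    ext y
    by_cases hy : y ∈ Set.univ.pi s
    · rw [Set.indicator_of_mem hy, shiftDensity,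
        ENNReal.ofReal_prod_of_nonneg fun i _ => (Real.exp_pos _).le]
      exact Finset.prod_congr rfl fun i _ => by rw [Set.indicator_of_mem (hy i trivial)]
    · rw [Set.indicator_of_notMem hy]
      simp only [Set.mem_univ_pi, not_forall] at hy
      obtain ⟨i, hi⟩ := hy
      exact (Finset.prod_eq_zero (Finset.mem_univ i) (Set.indicator_of_notMem hi _)).symm
  rw [heq, ProbabilityTheory.lintegral_prod_eq_prod_lintegral_of_indepFun _ _ hind
    fun i => (hm i).comp (measurable_pi_apply i)]
  refine Finset.prod_congr rfl fun i _ => ?_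
  rw [← gaussianReal_withDensity_exp, withDensity_apply _ (hs i), ← lintegral_indicator (hs i),
    stdGaussian]
  exact (measurePreserving_eval (fun _ => ProbabilityTheory.gaussianReal 0 1) i).lintegral_comp (hm i)

/-- Cameron-Martin formula for the standard Gaussian measure. -/
lemma integral_add_stdGaussian {n : ℕ} (b : Fin n → ℝ) (k : (Fin n → ℝ) → ℝ) :
    ∫ y, k (fun i => y i + b i) ∂(stdGaussian n) =
      ∫ y, shiftDensity b y * k y ∂(stdGaussian n) := by
  have hmap : (stdGaussian n).map (fun y i => y i + b i) =
      Measure.pi fun i => ProbabilityTheory.gaussianReal (b i) 1 := by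
    rw [stdGaussian, Measure.pi_map_pi (f := fun i z => z + b i) (fun i => by fun_prop)]
    simp [ProbabilityTheory.gaussianReal_map_add_const]
  have hemb : MeasurableEmbedding (fun (y : Fin n → ℝ) i => y i + b i) :=
    (MeasurableEquiv.addRight b).measurableEmbedding
  rw [← hemb.integral_map, hmap, ← stdGaussian_withDensity_shiftDensity,
    integral_withDensity_eq_integral_toReal_smul (measurable_shiftDensity b).ennreal_ofReal
      (Eventually.of_forall fun _ => ENNReal.ofReal_lt_top)]
  refine integral_congr_ae (Eventually.of_forall fun y => ?_)
  simp [ENNReal.toReal_ofReal (shiftDensity_pos b y).le]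

lemma integrable_exp_sum_abs {n : ℕ} (M : ℝ) :
    Integrable (fun y : Fin n → ℝ => Real.exp (M * ∑ i, |y i|)) (stdGaussian n) := by
  have h : Integrable (fun y : Fin n → ℝ => ∏ i, Real.exp (M * |y i|)) (stdGaussian n) :=
    Integrable.fintype_prod fun _ => ProbabilityTheory.integrable_exp_mul_abs
      (ProbabilityTheory.integrable_exp_mul_gaussianReal M)
      (ProbabilityTheory.integrable_exp_mul_gaussianReal (-M))
  simpa only [← Real.exp_sum, ← Finset.mul_sum] using h

lemma hasFDerivAt_shiftDensity {n : ℕ} (b y : Fin n → ℝ) :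
    HasFDerivAt (fun b => shiftDensity b y)
      (shiftDensity b y • ∑ i, (y i - b i) • ContinuousLinearMap.proj (R := ℝ) (φ := fun _ => ℝ) i)
      b := by
  simp only [shiftDensity_eq_exp]
  refine HasFDerivAt.exp (HasFDerivAt.fun_sum fun i _ => ?_)
  have hi : HasFDerivAt (fun b : Fin n → ℝ => b i)
    (ContinuousLinearMap.proj (R := ℝ) (φ := fun _ => ℝ) i) b := hasFDerivAt_apply i b
  refine ((hi.mul_const (y i)).sub ((hi.pow 2).mul_const (2 : ℝ)⁻¹)).congr_fderiv ?_ |>.congr_of_eventuallyEq ?_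
  · ext v
    simp
    ring
  · exact Eventually.of_forall fun b => by simp [div_eq_mul_inv]

lemma norm_sum_smul_proj_le {n : ℕ} (w : Fin n → ℝ) :
    ‖∑ i, w i • ContinuousLinearMap.proj (R := ℝ) (φ := fun _ : Fin n => ℝ) i‖ ≤ ∑ i, |w i| := by
  refine ContinuousLinearMap.opNorm_le_bound _ (Finset.sum_nonneg fun _ _ => abs_nonneg _)
    fun v => ?_
  simp only [_root_.sum_apply, _root_.smul_apply,
    ContinuousLinearMap.proj_apply, smul_eq_mul, Real.norm_eq_abs, Finset.sum_mul]
  refine (Finset.abs_sum_le_sum_abs _ _).trans (Finset.sum_le_sum fun i _ => ?_)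
  rw [abs_mul]
  exact mul_le_mul_of_nonneg_left (norm_le_pi_norm v i) (abs_nonneg _)

lemma shiftDensity_le {n : ℕ} {b : Fin n → ℝ} {R : ℝ} (hb : ∀ i, |b i| ≤ R) (y : Fin n → ℝ) :
    shiftDensity b y ≤ Real.exp (R * ∑ i, |y i|) := by
  rw [shiftDensity_eq_exp, Finset.mul_sum]
  refine Real.exp_le_exp.2 (Finset.sum_le_sum fun i _ => ?_)
  have h1 : b i * y i ≤ |b i| * |y i| := abs_mul (b i) (y i) ▸ le_abs_self _
  have h2 := mul_le_mul_of_nonneg_right (hb i) (abs_nonneg (y i))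
  nlinarith [sq_nonneg (b i)]

lemma sum_abs_sub_le_exp {n : ℕ} {b : Fin n → ℝ} {R : ℝ} (hb : ∀ i, |b i| ≤ R) (y : Fin n → ℝ) :
    ∑ i, |y i - b i| ≤ Real.exp (n * R) * Real.exp (∑ i, |y i|) := by
  have h : ∑ i, |y i - b i| ≤ n * R + ∑ i, |y i| := by
    calc ∑ i, |y i - b i| ≤ ∑ i, (R + |y i|) := Finset.sum_le_sum fun i _ => by
          have := abs_sub (y i) (b i)
          linarith [hb i]
      _ = n * R + ∑ i, |y i| := by simp [Finset.sum_add_distrib]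
  rw [← Real.exp_add]
  linarith [Real.add_one_le_exp (n * R + ∑ i, |y i|)]

/-- Differentiation of `b ↦ 𝔼 k(Y + b)` for a standard Gaussian vector `Y`. -/
lemma differentiableAt_and_pd_integral_add {n : ℕ} {k : (Fin n → ℝ) → ℝ} (hk : Measurable k)
    {C M : ℝ} (hkb : ∀ y, |k y| ≤ C * Real.exp (M * ∑ i, |y i|)) (b : Fin n → ℝ) :
    DifferentiableAt ℝ (fun b => ∫ y, k (fun i => y i + b i) ∂(stdGaussian n)) b ∧
      ∀ j, pd j (fun b => ∫ y, k (fun i => y i + b i) ∂(stdGaussian n)) b =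
        ∫ y, k (fun i => y i + b i) * y j ∂(stdGaussian n) := by
  have hC : 0 ≤ C := by
    have := (abs_nonneg _).trans (hkb 0)
    exact nonneg_of_mul_nonneg_left this (Real.exp_pos _)
  set R := ‖b‖ + 1 with hR
  have hball : ∀ b' ∈ Metric.ball b 1, ∀ i, |b' i| ≤ R := by
    intro b' hb' i
    have h1 := norm_le_pi_norm b' i
    have h2 := norm_le_norm_add_norm_sub' b' b
    rw [Metric.mem_ball, dist_eq_norm] at hb'
    rw [Real.norm_eq_abs] at h1
    linarith
  set F' : (Fin n → ℝ) → (Fin n → ℝ) → (Fin n → ℝ) →L[ℝ] ℝ := fun b y =>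
    (shiftDensity b y * k y) •
      ∑ i, (y i - b i) • ContinuousLinearMap.proj (R := ℝ) (φ := fun _ => ℝ) i with hF'
  set bound : (Fin n → ℝ) → ℝ := fun y =>
    (C * Real.exp (n * R)) * Real.exp ((M + R + 1) * ∑ i, |y i|) with hbd
  have hbi : Integrable bound (stdGaussian n) := (integrable_exp_sum_abs _).const_mul _
  have hbound : ∀ y, ∀ b' ∈ Metric.ball b 1, ‖F' b' y‖ ≤ bound y := by
    intro y b' hb'
    have e : bound y = (Real.exp (R * ∑ i, |y i|) * (C * Real.exp (M * ∑ i, |y i|))) *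
        (Real.exp (n * R) * Real.exp (∑ i, |y i|)) := by
      simp only [hbd, add_mul, one_mul, Real.exp_add]
      ring
    rw [e, hF', norm_smul, norm_mul, Real.norm_of_nonneg (shiftDensity_pos _ _).le,
      Real.norm_eq_abs]
    gcongr
    · exact shiftDensity_le (hball b' hb') y
    · exact hkb y
    · exact (norm_sum_smul_proj_le _).trans (sum_abs_sub_le_exp (hball b' hb') y)
  have hmeas : Measurable (F' b) := by
    rw [hF']
    have := measurable_shiftDensity b
    have h2 : Measurable fun y : Fin n → ℝ =>
        ∑ i, (y i - b i) • ContinuousLinearMap.proj (R := ℝ) (φ := fun _ : Fin n => ℝ) i := by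
      refine Finset.measurable_sum _ fun i _ => ?_
      exact Measurable.smul_const (by fun_prop) _
    exact (this.mul hk).smul h2
  have h_int' : Integrable (F' b) (stdGaussian n) :=
    hbi.mono' hmeas.aestronglyMeasurable
      (Eventually.of_forall fun y => hbound y b (Metric.mem_ball_self one_pos))
  have hd : HasFDerivAt (fun b => ∫ y, shiftDensity b y * k y ∂(stdGaussian n))
      (∫ y, F' b y ∂(stdGaussian n)) b := by
    refine hasFDerivAt_integral_of_dominated_of_fderiv_le (bound := bound)
      (Metric.ball_mem_nhds b one_pos)
      (Eventually.of_forall fun b' =>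
        ((measurable_shiftDensity b').mul hk).aestronglyMeasurable)
      ?_ h_int'.aestronglyMeasurable (Eventually.of_forall hbound) hbi
      (Eventually.of_forall fun y b' _ => ?_)
    · refine ((integrable_exp_sum_abs (R + M)).const_mul C).mono'
        ((measurable_shiftDensity b).mul hk).aestronglyMeasurable (Eventually.of_forall fun y => ?_)
      rw [norm_mul, Real.norm_of_nonneg (shiftDensity_pos _ _).le, Real.norm_eq_abs]
      calc _ ≤ Real.exp (R * ∑ i, |y i|) * (C * Real.exp (M * ∑ i, |y i|)) :=
            mul_le_mul (shiftDensity_le (hball b (Metric.mem_ball_self one_pos)) y) (hkb y)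
              (abs_nonneg _) (Real.exp_pos _).le
        _ = _ := by rw [add_mul R M, Real.exp_add, mul_left_comm]
    · refine ((hasFDerivAt_shiftDensity b' y).mul_const (k y)).congr_fderiv ?_
      rw [hF', smul_smul, mul_comm]
  simp only [integral_add_stdGaussian]
  refine ⟨hd.differentiableAt, fun j => ?_⟩
  rw [pd, hd.fderiv, ContinuousLinearMap.integral_apply h_int']
  have e := integral_add_stdGaussian b (fun y => k y * (y j - b j))
  simp only [add_sub_cancel_right] at e
  rw [e]
  refine integral_congr_ae (Eventually.of_forall fun y => ?_)
  simp only [hF', _root_.smul_apply, _root_.sum_apply,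
    ContinuousLinearMap.proj_apply, smul_eq_mul, Pi.single_apply, mul_ite, mul_one, mul_zero,
    Finset.sum_ite_eq', Finset.mem_univ, if_true]
  ring

lemma abs_le_exp_sum_abs {n : ℕ} (y : Fin n → ℝ) (i : Fin n) :
    |y i| ≤ Real.exp (∑ i, |y i|) := by
  have h := Finset.single_le_sum (f := fun i => |y i|) (fun _ _ => abs_nonneg _) (Finset.mem_univ i)
  linarith [Real.add_one_le_exp (∑ i, |y i|)]

lemma integrable_mul_coord {n : ℕ} {g : (Fin n → ℝ) → ℝ} (hg : Measurable g)
    (h1 : ∀ y, |g y| ≤ 1) (i : Fin n) : Integrable (fun y => g y * y i) (stdGaussian n) := by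
  refine (integrable_exp_sum_abs 1).mono' (by fun_prop) (Eventually.of_forall fun y => ?_)
  rw [norm_mul, Real.norm_eq_abs, Real.norm_eq_abs, one_mul, ← one_mul (Real.exp _)]
  exact mul_le_mul (h1 y) (abs_le_exp_sum_abs y i) (abs_nonneg _) zero_le_one

lemma integrable_mul_coord_mul_coord {n : ℕ} {g : (Fin n → ℝ) → ℝ} (hg : Measurable g)
    (h1 : ∀ y, |g y| ≤ 1) (i j : Fin n) :
    Integrable (fun y => g y * (y i * y j)) (stdGaussian n) := by
  refine (integrable_exp_sum_abs 2).mono' (by fun_prop) (Eventually.of_forall fun y => ?_)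
  rw [norm_mul, norm_mul, Real.norm_eq_abs, Real.norm_eq_abs, Real.norm_eq_abs, two_mul,
    Real.exp_add, ← one_mul (Real.exp _ * _)]
  have := abs_le_exp_sum_abs y
  exact mul_le_mul (h1 y) (mul_le_mul (this i) (this j) (abs_nonneg _) (Real.exp_pos _).le)
    (by positivity) zero_le_one

lemma integrable_of_abs_le_one {n : ℕ} {g : (Fin n → ℝ) → ℝ} (hg : Measurable g)
    (h1 : ∀ y, |g y| ≤ 1) : Integrable g (stdGaussian n) :=
  (integrable_const (1 : ℝ)).mono' hg.aestronglyMeasurable (Eventually.of_forall h1)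

/-- The first Gaussian moments of `g`. -/
noncomputable def levelOne {n : ℕ} (g : (Fin n → ℝ) → ℝ) (i : Fin n) : ℝ :=
  ∫ y, g y * y i ∂(stdGaussian n)

/-- The second Gaussian moments of `g` (unnormalised degree-two Hermite coefficients). -/
noncomputable def levelTwo {n : ℕ} (g : (Fin n → ℝ) → ℝ) (i j : Fin n) : ℝ :=
  ∫ y, g y * (y i * y j - if i = j then 1 else 0) ∂(stdGaussian n)

lemma pd_integral_add {n : ℕ} {g : (Fin n → ℝ) → ℝ} (hg : Measurable g) (h1 : ∀ y, |g y| ≤ 1)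
    (b : Fin n → ℝ) :
    DifferentiableAt ℝ (fun b => ∫ y, g (fun i => y i + b i) ∂(stdGaussian n)) b ∧
      ∀ j, pd j (fun b => ∫ y, g (fun i => y i + b i) ∂(stdGaussian n)) b =
        levelOne (fun y => g (fun i => y i + b i)) j :=
  differentiableAt_and_pd_integral_add hg (C := 1) (M := 0) (fun y => by simpa using h1 y) b

lemma levelTwo_eq {n : ℕ} {g : (Fin n → ℝ) → ℝ} (hg : Measurable g) (h1 : ∀ y, |g y| ≤ 1)
    (i j : Fin n) : levelTwo g i j = (∫ y, g y * (y i * y j) ∂(stdGaussian n)) -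
      (if i = j then 1 else 0) * ∫ y, g y ∂(stdGaussian n) := by
  rw [levelTwo, ← integral_const_mul, ← integral_sub (integrable_mul_coord_mul_coord hg h1 i j)
    ((integrable_of_abs_le_one hg h1).const_mul _)]
  refine integral_congr_ae (Eventually.of_forall fun y => ?_)
  simp only
  ring

lemma pd_levelOne_add {n : ℕ} {g : (Fin n → ℝ) → ℝ} (hg : Measurable g) (h1 : ∀ y, |g y| ≤ 1)
    (i : Fin n) (b : Fin n → ℝ) :
    DifferentiableAt ℝ (fun b => levelOne (fun y => g (fun i => y i + b i)) i) b ∧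
      ∀ j, pd j (fun b => levelOne (fun y => g (fun i => y i + b i)) i) b =
        levelTwo (fun y => g (fun i => y i + b i)) i j := by
  have hgb : ∀ b : Fin n → ℝ, Measurable fun y : Fin n → ℝ => g (fun i => y i + b i) :=
    fun b => hg.comp (by fun_prop)
  have heq : (fun b : Fin n → ℝ => levelOne (fun y => g (fun i => y i + b i)) i) = fun b =>
      (∫ y, (fun z => g z * z i) (fun i => y i + b i) ∂(stdGaussian n)) -
        b i * ∫ y, g (fun i => y i + b i) ∂(stdGaussian n) := by
    ext b
    have hb := hgb b
    have e1 := integrable_mul_coord hb (fun _ => h1 _) i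
    have e2 := integrable_of_abs_le_one hb (fun _ => h1 _)
    simp only [mul_add]
    rw [integral_add e1 (e2.mul_const _), integral_mul_const, levelOne]
    ring
  obtain ⟨d1, p1⟩ := differentiableAt_and_pd_integral_add (k := fun z => g z * z i)
    (by fun_prop) (C := 1) (M := 1) (fun y => by
      rw [abs_mul, one_mul (Finset.sum _ _)]
      exact mul_le_mul (h1 y) (abs_le_exp_sum_abs y i) (abs_nonneg _) zero_le_one) b
  obtain ⟨d2, p2⟩ := pd_integral_add hg h1 b
  have hi : HasFDerivAt (fun b : Fin n → ℝ => b i)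
    (ContinuousLinearMap.proj (R := ℝ) (φ := fun _ => ℝ) i) b := hasFDerivAt_apply i b
  have hd := d1.hasFDerivAt.sub (hi.mul d2.hasFDerivAt)
  rw [heq]
  refine ⟨hd.differentiableAt, fun j => ?_⟩
  rw [pd]
  erw [hd.fderiv]
  have e : ∀ j, fderiv ℝ (fun b => ∫ y, g (fun i => y i + b i) ∂(stdGaussian n)) b
      (Pi.single j 1) = _ := p2
  have e' : ∀ j, fderiv ℝ (fun b => ∫ y, (fun z => g z * z i) (fun i => y i + b i)
      ∂(stdGaussian n)) b (Pi.single j 1) = _ := p1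
  have hb := hgb b
  have i1 := integrable_mul_coord_mul_coord hb (fun _ => h1 _) i j
  have i2 := (integrable_mul_coord hb (fun _ => h1 _) j).const_mul (b i)
  rw [levelTwo_eq hb (fun _ => h1 _)]
  simp only [_root_.sub_apply, _root_.add_apply, _root_.smul_apply, ContinuousLinearMap.proj_apply,
    e, e', smul_eq_mul, Pi.single_apply]
  have i3 : ∫ y, g (fun i => y i + b i) * (y i + b i) * y j ∂(stdGaussian n) =
      (∫ y, g (fun i => y i + b i) * (y i * y j) ∂(stdGaussian n)) +
        b i * levelOne (fun y => g (fun i => y i + b i)) j := by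
    rw [levelOne, ← integral_const_mul, ← integral_add i1 i2]
    refine integral_congr_ae (Eventually.of_forall fun y => ?_)
    simp only
    ring
  rw [i3]
  ring

/-- Entropy inequality: the mass that `g` gives to `X` is controlled by exponential moments. -/
lemma integral_mul_le_of_integral_exp_le {Ω : Type*} [MeasurableSpace Ω] {μ : Measure Ω}
    {g X : Ω → ℝ} {m : ℝ} (hg0 : ∀ y, 0 ≤ g y) (hg1 : ∀ y, g y ≤ 1) (hg : Integrable g μ)
    (hpos : 0 < ∫ y, g y ∂μ) (hgX : Integrable (fun y => g y * X y) μ)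
    (hX : Integrable (fun y => Real.exp (X y)) μ) (hm : ∫ y, Real.exp (X y) ∂μ ≤ Real.exp m) :
    ∫ y, g y * X y ∂μ ≤ (∫ y, g y ∂μ) * (Real.log (1 / ∫ y, g y ∂μ) + m) := by
  set a := ∫ y, g y ∂μ with ha
  set c := m + Real.log (1 / a) with hc
  have h1 : ∫ y, g y * X y ∂μ ≤ ∫ y, (Real.exp (-c) * Real.exp (X y) + (c - 1) * g y) ∂μ := by
    refine integral_mono hgX ((hX.const_mul _).add (hg.const_mul _)) fun y => ?_
    simp only
    have h2 := Real.add_one_le_exp (-c + X y)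
    rw [← Real.exp_add]
    have h3 := mul_le_mul_of_nonneg_left h2 (hg0 y)
    have h4 := mul_le_of_le_one_left (Real.exp_pos (-c + X y)).le (hg1 y)
    linarith
  rw [integral_add (hX.const_mul _) (hg.const_mul _), integral_const_mul, integral_const_mul,
    ← ha] at h1
  have h5 : Real.exp (-c) * Real.exp m = a := by
    rw [← Real.exp_add, hc, one_div, Real.log_inv]
    ring_nf
    exact Real.exp_log hpos
  have h6 := mul_le_mul_of_nonneg_left hm (Real.exp_pos (-c)).le
  rw [h5] at h6
  calc _ ≤ _ := h1
    _ ≤ a + (c - 1) * a := by linarith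
    _ = a * (Real.log (1 / a) + m) := by rw [hc]; ring

lemma integrable_exp_sum_mul {n : ℕ} (w : Fin n → ℝ) :
    Integrable (fun y : Fin n → ℝ => Real.exp (∑ i, w i * y i)) (stdGaussian n) := by
  simp only [Real.exp_sum]
  exact Integrable.fintype_prod fun i => ProbabilityTheory.integrable_exp_mul_gaussianReal (w i)

lemma integral_exp_sum_mul {n : ℕ} (w : Fin n → ℝ) :
    ∫ y, Real.exp (∑ i, w i * y i) ∂(stdGaussian n) = Real.exp ((∑ i, w i ^ 2) / 2) := by
  simp only [Real.exp_sum, Finset.sum_div]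
  rw [stdGaussian, integral_fintype_prod_eq_prod (fun i z => Real.exp (w i * z))]
  refine Finset.prod_congr rfl fun i _ => ?_
  have h := congrFun (ProbabilityTheory.mgf_id_gaussianReal (μ := 0) (v := 1)) (w i)
  simpa [ProbabilityTheory.mgf] using h

/-- Level-one inequality in Gauss space. -/
lemma sum_levelOne_sq_le {n : ℕ} {g : (Fin n → ℝ) → ℝ} (hg : Measurable g) (h0 : ∀ y, 0 ≤ g y)
    (h1 : ∀ y, g y ≤ 1) (hpos : 0 < ∫ y, g y ∂(stdGaussian n)) :
    ∑ i, levelOne g i ^ 2 ≤ 2 * (∫ y, g y ∂(stdGaussian n)) ^ 2 *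
      Real.log (1 / ∫ y, g y ∂(stdGaussian n)) := by
  set a := ∫ y, g y ∂(stdGaussian n) with ha
  have habs : ∀ y, |g y| ≤ 1 := fun y => abs_le.2 ⟨by linarith [h0 y], h1 y⟩
  have hS : ∫ y, g y * ∑ i, (levelOne g i / a) * y i ∂(stdGaussian n) =
      (∑ i, levelOne g i ^ 2) / a := by
    simp only [Finset.mul_sum, mul_left_comm (g _)]
    rw [integral_finsetSum _ fun i _ => (integrable_mul_coord hg habs i).const_mul _,
      Finset.sum_div]
    refine Finset.sum_congr rfl fun i _ => ?_
    rw [integral_const_mul, ← levelOne]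
    ring
  have h_int : Integrable (fun y => g y * ∑ i, (levelOne g i / a) * y i) (stdGaussian n) := by
    simp only [Finset.mul_sum, mul_left_comm (g _)]
    exact integrable_finsetSum _ fun i _ => (integrable_mul_coord hg habs i).const_mul _
  have h := integral_mul_le_of_integral_exp_le h0 h1 (integrable_of_abs_le_one hg habs) hpos h_int
    (integrable_exp_sum_mul _) (integral_exp_sum_mul _).le
  rw [hS, ← ha] at h
  simp only [div_pow, ← Finset.sum_div] at h
  rw [div_le_iff₀ hpos] at h
  have e : a * (Real.log (1 / a) + (∑ i, levelOne g i ^ 2) / a ^ 2 / 2) * a =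
      a ^ 2 * Real.log (1 / a) + (∑ i, levelOne g i ^ 2) / 2 := by
    field_simp
  rw [e] at h
  linarith

lemma one_le_one_sub_mul_exp {x : ℝ} (hx : |x| ≤ 1 / 2) :
    1 ≤ (1 - x) * Real.exp (x + x ^ 2) := by
  obtain ⟨hl, hu⟩ := abs_le.1 hx
  rcases le_total 0 x with h | h
  · have hq := Real.quadratic_le_exp_of_nonneg (show 0 ≤ x + x ^ 2 by positivity)
    have h2 : (1 - x) * (1 + (x + x ^ 2) + (x + x ^ 2) ^ 2 / 2) ≤
        (1 - x) * Real.exp (x + x ^ 2) := mul_le_mul_of_nonneg_left hq (by linarith)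
    refine le_trans ?_ h2
    have h3 : x ^ 3 ≤ x ^ 2 / 2 := by nlinarith [sq_nonneg x]
    have h4 : x ^ 4 ≤ x ^ 2 / 4 := by nlinarith [sq_nonneg x]
    have h5 : x ^ 5 ≤ x ^ 2 / 8 := by nlinarith [sq_nonneg x]
    nlinarith [sq_nonneg x]
  · have h2 := mul_le_mul_of_nonneg_left (Real.add_one_le_exp (x + x ^ 2))
      (show 0 ≤ 1 - x by linarith)
    refine le_trans ?_ h2
    nlinarith [mul_nonneg (neg_nonneg.2 h) (sq_nonneg x)]

lemma integrable_and_integral_exp_mul_sq_sub_one_le {c : ℝ} (hc : |c| ≤ 1 / 4) :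
    Integrable (fun z : ℝ => Real.exp (c * (z ^ 2 - 1))) (ProbabilityTheory.gaussianReal 0 1) ∧
      ∫ z, Real.exp (c * (z ^ 2 - 1)) ∂(ProbabilityTheory.gaussianReal 0 1) ≤
        Real.exp (2 * c ^ 2) := by
  obtain ⟨hl, hu⟩ := abs_le.1 hc
  have hb : 0 < 1 / 2 - c := by linarith
  have hden : ∀ z : ℝ, ProbabilityTheory.gaussianPDFReal 0 1 z * Real.exp (c * (z ^ 2 - 1)) =
      ((Real.sqrt (2 * Real.pi))⁻¹ * Real.exp (-c)) * Real.exp (-(1 / 2 - c) * z ^ 2) := by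
    intro z
    rw [← gaussPhi_eq_gaussianPDFReal, gaussPhi, mul_assoc, mul_assoc, ← Real.exp_add,
      ← Real.exp_add]
    ring_nf
  constructor
  · rw [ProbabilityTheory.gaussianReal_of_var_ne_zero _ one_ne_zero,
      integrable_withDensity_iff_integrable_smul' (by fun_prop)
        (Eventually.of_forall fun _ => ProbabilityTheory.gaussianPDF_lt_top)]
    simp only [ProbabilityTheory.toReal_gaussianPDF, smul_eq_mul, hden]
    exact (integrable_exp_neg_mul_sq hb).const_mul _
  · rw [ProbabilityTheory.integral_gaussianReal_eq_integral_smul one_ne_zero]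
    simp only [smul_eq_mul, hden]
    rw [integral_const_mul, integral_gaussian]
    have hx := one_le_one_sub_mul_exp (x := 2 * c) (by rw [abs_le]; constructor <;> linarith)
    have hs : (Real.sqrt (2 * Real.pi))⁻¹ * Real.exp (-c) * Real.sqrt (Real.pi / (1 / 2 - c)) =
        Real.exp (-c) * (Real.sqrt (1 - 2 * c))⁻¹ := by
      have : Real.pi / (1 / 2 - c) = (2 * Real.pi) / (1 - 2 * c) := by
        rw [div_eq_div_iff hb.ne' (by linarith)]
        ring
      rw [this, Real.sqrt_div (by positivity)]
      have : Real.sqrt (2 * Real.pi) ≠ 0 := by positivity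
      field_simp
    rw [hs, ← div_eq_mul_inv, div_le_iff₀ (Real.sqrt_pos.2 (by linarith))]
    have h2 : Real.exp (c + 2 * c ^ 2) = Real.sqrt (Real.exp (2 * c + (2 * c) ^ 2)) := by
      rw [Real.sqrt_eq_rpow, ← Real.exp_mul]
      ring_nf
    have h3 : 1 ≤ Real.sqrt (1 - 2 * c) * Real.exp (c + 2 * c ^ 2) := by
      rw [h2, ← Real.sqrt_mul (by linarith)]
      exact Real.one_le_sqrt.2 hx
    calc Real.exp (-c) ≤ Real.exp (-c) * (Real.sqrt (1 - 2 * c) * Real.exp (c + 2 * c ^ 2)) :=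
          le_mul_of_one_le_right (Real.exp_pos _).le h3
      _ = (Real.exp (-c) * Real.exp (c + 2 * c ^ 2)) * Real.sqrt (1 - 2 * c) := by ring
      _ = Real.exp (2 * c ^ 2) * Real.sqrt (1 - 2 * c) := by rw [← Real.exp_add]; ring_nf

lemma map_mulVec_eigenvectorUnitary_stdGaussian {n : ℕ} {B : Matrix (Fin n) (Fin n) ℝ}
    (hB : B.IsHermitian) :
    MeasurePreserving (fun y => (hB.eigenvectorUnitary : Matrix (Fin n) (Fin n) ℝ).mulVec y)
      (stdGaussian n) (stdGaussian n) := by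
  have hm : Measurable fun y : Fin n → ℝ =>
      (hB.eigenvectorUnitary : Matrix (Fin n) (Fin n) ℝ).mulVec y :=
    measurable_pi_iff.2 fun i => by
      simp only [Matrix.mulVec, dotProduct]
      fun_prop
  refine ⟨hm, ?_⟩
  have h := (ProbabilityTheory.map_pi_eq_stdGaussian (ι := Fin n)).trans
    (ProbabilityTheory.stdGaussian_eq_map_pi_orthonormalBasis hB.eigenvectorBasis)
  have h2 := congrArg (Measure.map (WithLp.ofLp (p := 2))) h
  rw [Measure.map_map (by fun_prop) (by fun_prop), Measure.map_map (by fun_prop) (by fun_prop)] at h2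
  have e1 : (WithLp.ofLp (p := 2) ∘ WithLp.toLp 2 : (Fin n → ℝ) → Fin n → ℝ) = id := rfl
  rw [e1, Measure.map_id] at h2
  rw [stdGaussian]
  refine Eq.trans ?_ h2.symm
  congr 1
  ext y i
  simp [Matrix.mulVec, dotProduct, mul_comm]

lemma trace_mul_self_eq_sum_eigenvalues_sq {n : ℕ} {B : Matrix (Fin n) (Fin n) ℝ}
    (hB : B.IsHermitian) : ∑ i, ∑ j, B i j ^ 2 = ∑ k, hB.eigenvalues k ^ 2 := by
  have h1 : ∑ i, ∑ j, B i j ^ 2 = (B * B).trace := by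
    simp only [Matrix.trace, Matrix.diag_apply, Matrix.mul_apply]
    refine Finset.sum_congr rfl fun i _ => Finset.sum_congr rfl fun j _ => ?_
    have : B j i = B i j := by simpa using hB.apply i j
    rw [this, sq]
  have h2 : B * B = Unitary.conjStarAlgAut ℝ _ hB.eigenvectorUnitary
      (Matrix.diagonal hB.eigenvalues * Matrix.diagonal hB.eigenvalues) := by
    rw [map_mul]
    have := hB.spectral_theorem
    rw [show (RCLike.ofReal ∘ hB.eigenvalues : Fin n → ℝ) = hB.eigenvalues from rfl] at this
    rw [← this]
  rw [h1, h2, Unitary.conjStarAlgAut_apply, Matrix.trace_mul_comm, ← mul_assoc]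
  simp [Matrix.trace, sq]

lemma sum_mul_mulVec_eigenvectorUnitary {n : ℕ} {B : Matrix (Fin n) (Fin n) ℝ}
    (hB : B.IsHermitian) (y : Fin n → ℝ) :
    ∑ i, ∑ j, B i j *
      ((hB.eigenvectorUnitary : Matrix (Fin n) (Fin n) ℝ).mulVec y i *
        (hB.eigenvectorUnitary : Matrix (Fin n) (Fin n) ℝ).mulVec y j - if i = j then 1 else 0) =
      ∑ k, hB.eigenvalues k * (y k ^ 2 - 1) := by
  set U := (hB.eigenvectorUnitary : Matrix (Fin n) (Fin n) ℝ) with hU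
  have htr : ∑ i, B i i = ∑ k, hB.eigenvalues k := by
    have := hB.trace_eq_sum_eigenvalues
    simpa [Matrix.trace] using this
  have hD : U.transpose * B * U = Matrix.diagonal hB.eigenvalues := by
    have := hB.conjStarAlgAut_star_eigenvectorUnitary
    rw [Unitary.conjStarAlgAut_star_apply] at this
    exact this
  have hq : ∑ i, ∑ j, B i j * (U.mulVec y i * U.mulVec y j) = ∑ k, hB.eigenvalues k * y k ^ 2 := by
    calc _ = dotProduct (U.mulVec y) (B.mulVec (U.mulVec y)) := by
          simp only [dotProduct, Matrix.mulVec, Finset.mul_sum]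
          refine Finset.sum_congr rfl fun i _ => Finset.sum_congr rfl fun j _ => ?_
          simp only [Finset.sum_mul, Finset.mul_sum]
          refine Finset.sum_congr rfl fun k _ => Finset.sum_congr rfl fun l _ => ?_
          ring
      _ = dotProduct y ((U.transpose * B * U).mulVec y) := by
          rw [← Matrix.mulVec_mulVec, ← Matrix.mulVec_mulVec, Matrix.dotProduct_mulVec y,
            Matrix.vecMul_transpose]
      _ = _ := by
          rw [hD]
          simp only [dotProduct, Matrix.mulVec_diagonal]
          exact Finset.sum_congr rfl fun k _ => by ring
  simp only [mul_sub, Finset.sum_sub_distrib, mul_ite, mul_one, mul_zero, Finset.sum_ite_eq,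
    Finset.mem_univ, if_true]
  rw [hq, htr]

/-- Exponential moments of a centred Gaussian quadratic form. -/
lemma integrable_and_integral_exp_quadratic_le {n : ℕ} {B : Matrix (Fin n) (Fin n) ℝ}
    (hB : B.IsHermitian) (hsmall : ∑ i, ∑ j, B i j ^ 2 ≤ 1 / 16) :
    Integrable (fun y : Fin n → ℝ =>
        Real.exp (∑ i, ∑ j, B i j * (y i * y j - if i = j then 1 else 0))) (stdGaussian n) ∧
      ∫ y, Real.exp (∑ i, ∑ j, B i j * (y i * y j - if i = j then 1 else 0)) ∂(stdGaussian n) ≤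
        Real.exp (2 * ∑ i, ∑ j, B i j ^ 2) := by
  have hT := map_mulVec_eigenvectorUnitary_stdGaussian hB
  have hmeas : Measurable (fun y : Fin n → ℝ =>
      Real.exp (∑ i, ∑ j, B i j * (y i * y j - if i = j then 1 else 0))) := by fun_prop
  rw [trace_mul_self_eq_sum_eigenvalues_sq hB] at hsmall ⊢
  have hα : ∀ k, |hB.eigenvalues k| ≤ 1 / 4 := fun k => by
    have := Finset.single_le_sum (f := fun k => hB.eigenvalues k ^ 2)
      (fun _ _ => sq_nonneg _) (Finset.mem_univ k)
    exact abs_le_of_sq_le_sq (by norm_num; norm_num at hsmall this; linarith) (by norm_num)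
  have hcomp : ∀ y, Real.exp (∑ i, ∑ j, B i j *
      ((hB.eigenvectorUnitary : Matrix (Fin n) (Fin n) ℝ).mulVec y i *
        (hB.eigenvectorUnitary : Matrix (Fin n) (Fin n) ℝ).mulVec y j - if i = j then 1 else 0)) =
      ∏ k, Real.exp (hB.eigenvalues k * (y k ^ 2 - 1)) := fun y => by
    rw [sum_mul_mulVec_eigenvectorUnitary hB, Real.exp_sum]
  constructor
  · rw [← hT.integrable_comp hmeas.aestronglyMeasurable]
    simp only [Function.comp_def, hcomp]
    exact Integrable.fintype_prod (f := fun k z => Real.exp (hB.eigenvalues k * (z ^ 2 - 1)))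
      fun k => (integrable_and_integral_exp_mul_sq_sub_one_le (hα k)).1
  · rw [← hT.map_eq, integral_map hT.measurable.aemeasurable hmeas.aestronglyMeasurable]
    simp only [hcomp]
    rw [stdGaussian, integral_fintype_prod_eq_prod
      (fun k z => Real.exp (hB.eigenvalues k * (z ^ 2 - 1))), Finset.mul_sum, Real.exp_sum]
    exact Finset.prod_le_prod (fun k _ => integral_nonneg fun _ => (Real.exp_pos _).le)
      fun k _ => (integrable_and_integral_exp_mul_sq_sub_one_le (hα k)).2

/-- Level-two inequality in Gauss space. -/
lemma sum_levelTwo_sq_le {n : ℕ} {g : (Fin n → ℝ) → ℝ} (hg : Measurable g) (h0 : ∀ y, 0 ≤ g y)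
    (h1 : ∀ y, g y ≤ 1) (hpos : 0 < ∫ y, g y ∂(stdGaussian n)) :
    Real.sqrt (∑ i, ∑ j, levelTwo g i j ^ 2) ≤ 4 * (∫ y, g y ∂(stdGaussian n)) *
      (Real.log (1 / ∫ y, g y ∂(stdGaussian n)) + 1 / 8) := by
  have habs : ∀ y, |g y| ≤ 1 := fun y => abs_le.2 ⟨by linarith [h0 y], h1 y⟩
  set a := ∫ y, g y ∂(stdGaussian n) with ha
  set S := ∑ i, ∑ j, levelTwo g i j ^ 2 with hS
  have hS0 : 0 ≤ S := Finset.sum_nonneg fun _ _ => Finset.sum_nonneg fun _ _ => sq_nonneg _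
  rcases hS0.eq_or_lt with hz | hSpos
  · have ha1 : a ≤ 1 := by
      have := integral_mono (integrable_of_abs_le_one hg habs) (integrable_const (1 : ℝ)) h1
      simpa using this
    have hl : 0 ≤ Real.log (1 / a) := Real.log_nonneg (by rw [one_le_div hpos]; exact ha1)
    rw [← hz, Real.sqrt_zero]
    positivity
  set s := Real.sqrt S with hs
  have hspos : 0 < s := Real.sqrt_pos.2 hSpos
  have hss : s ^ 2 = S := Real.sq_sqrt hS0
  set B : Matrix (Fin n) (Fin n) ℝ := Matrix.of fun i j => levelTwo g i j / (4 * s) with hBdef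
  have hB : B.IsHermitian := by
    ext i j
    simp only [hBdef, Matrix.conjTranspose_apply, Matrix.of_apply, levelTwo, star_trivial,
      mul_comm, eq_comm]
  have hBS : ∑ i, ∑ j, B i j ^ 2 = 1 / 16 := by
    simp only [hBdef, Matrix.of_apply, div_pow, ← Finset.sum_div, ← hS]
    rw [← hss]
    field_simp
    norm_num
  obtain ⟨hi, hle⟩ := integrable_and_integral_exp_quadratic_le hB hBS.le
  have hterm : ∀ i j, Integrable
      (fun y => g y * (B i j * (y i * y j - if i = j then 1 else 0))) (stdGaussian n) := by
    intro i j
    have e : (fun y : Fin n → ℝ => g y * (B i j * (y i * y j - if i = j then 1 else 0))) =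
        fun y => B i j * (g y * (y i * y j)) - (B i j * if i = j then 1 else 0) * g y := by
      ext y
      ring
    rw [e]
    exact ((integrable_mul_coord_mul_coord hg habs i j).const_mul _).sub
      ((integrable_of_abs_le_one hg habs).const_mul _)
  have h_int : Integrable (fun y => g y *
      ∑ i, ∑ j, B i j * (y i * y j - if i = j then 1 else 0)) (stdGaussian n) := by
    simp only [Finset.mul_sum]
    exact integrable_finsetSum _ fun i _ => integrable_finsetSum _ fun j _ => hterm i j
  have hval : ∫ y, g y * ∑ i, ∑ j, B i j * (y i * y j - if i = j then 1 else 0)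
      ∂(stdGaussian n) = s / 4 := by
    simp only [Finset.mul_sum]
    rw [integral_finsetSum _ fun i _ => integrable_finsetSum _ fun j _ => hterm i j]
    have : ∀ i, ∫ y, ∑ j, g y * (B i j * (y i * y j - if i = j then 1 else 0))
        ∂(stdGaussian n) = ∑ j, levelTwo g i j ^ 2 / (4 * s) := by
      intro i
      rw [integral_finsetSum _ fun j _ => hterm i j]
      refine Finset.sum_congr rfl fun j _ => ?_
      simp only [mul_left_comm (g _)]
      rw [integral_const_mul, ← levelTwo, hBdef, Matrix.of_apply]
      ring
    simp only [this, ← Finset.sum_div, ← hS]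
    rw [← hss]
    field_simp
  have h := integral_mul_le_of_integral_exp_le h0 h1 (integrable_of_abs_le_one hg habs) hpos h_int
    hi hle
  rw [hval, hBS, ← ha] at h
  linarith

lemma sum_hessian_sq_le_of_nonpos {n : ℕ} {g : (Fin n → ℝ) → ℝ} (hg : Measurable g)
    (h0 : ∀ y, 0 ≤ g y) (h1 : ∀ y, g y ≤ 1) {q : ℝ} (hq : q ≤ 0)
    (hgq : ∫ y, g y ∂(stdGaussian n) = gaussCdf q) (hpos : 0 < gaussCdf q) :
    ∑ i, ∑ j, (levelTwo g i j / gaussPhi q +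
        q * levelOne g i * levelOne g j / gaussPhi q ^ 2) ^ 2 ≤
      22500 * Real.log (1 / gaussCdf q) := by
  have hpos' : 0 < ∫ y, g y ∂(stdGaussian n) := hgq ▸ hpos
  have hV := sum_levelOne_sq_le hg h0 h1 hpos'
  have hS := sum_levelTwo_sq_le hg h0 h1 hpos'
  rw [hgq] at hV hS
  obtain ⟨hL, hqL, haL⟩ := gaussCdf_tail_bounds hq
  have hφ := gaussPhi_pos q
  set a := gaussCdf q
  set L := Real.log (1 / a)
  set p := gaussPhi q
  set V := ∑ i, levelOne g i ^ 2 with hVdef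
  set S := ∑ i, ∑ j, levelTwo g i j ^ 2 with hSdef
  have hV0 : 0 ≤ V := Finset.sum_nonneg fun _ _ => sq_nonneg _
  have hS0 : 0 ≤ S := Finset.sum_nonneg fun _ _ => Finset.sum_nonneg fun _ _ => sq_nonneg _
  have hS2 : S ≤ 25 * a ^ 2 * L ^ 2 := by
    have h : √S ≤ 5 * a * L := hS.trans (by nlinarith)
    calc S = √S ^ 2 := (Real.sq_sqrt hS0).symm
      _ ≤ (5 * a * L) ^ 2 := pow_le_pow_left₀ (Real.sqrt_nonneg _) h 2
      _ = _ := by ring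
  have hS3 : S ≤ 800 * L * p ^ 2 := by nlinarith
  have hV2 : V ≤ 64 * p ^ 2 := by nlinarith
  have hV3 : V ^ 2 ≤ (64 * p ^ 2) ^ 2 := pow_le_pow_left₀ hV0 hV2 2
  have hVV : ∑ i, ∑ j, (levelOne g i * levelOne g j) ^ 2 = V ^ 2 := by
    simp only [mul_pow, ← Finset.mul_sum, ← Finset.sum_mul, hVdef, sq (∑ i, _)]
  calc _ ≤ ∑ i, ∑ j, (2 / p ^ 2 * levelTwo g i j ^ 2 +
        2 * q ^ 2 / p ^ 4 * (levelOne g i * levelOne g j) ^ 2) := by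
        refine Finset.sum_le_sum fun i _ => Finset.sum_le_sum fun j _ => ?_
        refine (add_sq_le).trans (le_of_eq ?_)
        field_simp
    _ = 2 / p ^ 2 * S + 2 * q ^ 2 / p ^ 4 * V ^ 2 := by
        simp only [Finset.sum_add_distrib, ← Finset.mul_sum, hVV, hSdef]
    _ ≤ 2 / p ^ 2 * (800 * L * p ^ 2) + 2 * (2 * L) / p ^ 4 * (64 * p ^ 2) ^ 2 := by
        gcongr
    _ = 17984 * L := by
        field_simp
        ring
    _ ≤ _ := by linarith

lemma pd_const {n : ℕ} (i : Fin n) (c : ℝ) (b : Fin n → ℝ) :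
    pd i (fun _ : Fin n → ℝ => c) b = 0 := by
  simp [pd]

lemma levelOne_one {n : ℕ} (i : Fin n) : levelOne (fun _ : Fin n → ℝ => (1 : ℝ)) i = 0 := by
  rw [← (pd_integral_add measurable_const (g := fun _ : Fin n → ℝ => (1 : ℝ)) (by simp) 0).2 i]
  exact pd_const i _ 0

lemma levelTwo_one {n : ℕ} (i j : Fin n) :
    levelTwo (fun _ : Fin n → ℝ => (1 : ℝ)) i j = 0 := by
  rw [← (pd_levelOne_add measurable_const (g := fun _ : Fin n → ℝ => (1 : ℝ)) (by simp) i 0).2 j]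
  exact pd_const j _ 0

lemma levelOne_one_sub {n : ℕ} {g : (Fin n → ℝ) → ℝ} (hg : Measurable g)
    (h1 : ∀ y, |g y| ≤ 1) (i : Fin n) : levelOne (fun y => 1 - g y) i = -levelOne g i := by
  rw [← zero_sub, ← levelOne_one i]
  simp only [levelOne]
  rw [← integral_sub (integrable_mul_coord measurable_const (by simp) i)
    (integrable_mul_coord hg h1 i)]
  simp only [sub_mul]

lemma levelTwo_one_sub {n : ℕ} {g : (Fin n → ℝ) → ℝ} (hg : Measurable g)
    (h1 : ∀ y, |g y| ≤ 1) (i j : Fin n) :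
    levelTwo (fun y => 1 - g y) i j = -levelTwo g i j := by
  have h_int : ∀ {k : (Fin n → ℝ) → ℝ}, Measurable k → (∀ y, |k y| ≤ 1) →
      Integrable (fun y => k y * (y i * y j - if i = j then 1 else 0)) (stdGaussian n) := by
    intro k hk hk1
    simp only [mul_sub]
    exact (integrable_mul_coord_mul_coord hk hk1 i j).sub
      ((integrable_of_abs_le_one hk hk1).mul_const _)
  rw [← zero_sub, ← levelTwo_one i j]
  simp only [levelTwo]
  rw [← integral_sub (h_int measurable_const (by simp)) (h_int hg h1)]
  simp only [sub_mul]

lemma integral_one_sub {n : ℕ} {g : (Fin n → ℝ) → ℝ} (hg : Measurable g)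
    (h1 : ∀ y, |g y| ≤ 1) :
    ∫ y, (1 - g y) ∂(stdGaussian n) = 1 - ∫ y, g y ∂(stdGaussian n) := by
  rw [integral_sub (integrable_const _) (integrable_of_abs_le_one hg h1)]
  simp

lemma sum_hessian_sq_le {n : ℕ} {g : (Fin n → ℝ) → ℝ} (hg : Measurable g)
    (h0 : ∀ y, 0 ≤ g y) (h1 : ∀ y, g y ≤ 1) {q : ℝ}
    (hgq : ∫ y, g y ∂(stdGaussian n) = gaussCdf q) (hpos : 0 < gaussCdf q)
    (hlt : gaussCdf q < 1) :
    ∑ i, ∑ j, (levelTwo g i j / gaussPhi q +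
        q * levelOne g i * levelOne g j / gaussPhi q ^ 2) ^ 2 ≤
      22500 * Real.log (1 / (gaussCdf q * (1 - gaussCdf q))) := by
  have habs : ∀ y, |g y| ≤ 1 := fun y => abs_le.2 ⟨by linarith [h0 y], h1 y⟩
  have hlog : Real.log (1 / (gaussCdf q * (1 - gaussCdf q))) =
      Real.log (1 / gaussCdf q) + Real.log (1 / (1 - gaussCdf q)) := by
    rw [← Real.log_mul (by positivity) (by
      have : 0 < 1 - gaussCdf q := by linarith
      positivity)]
    congr 1
    field_simp
  have hl1 : 0 ≤ Real.log (1 / gaussCdf q) :=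
    Real.log_nonneg (by rw [one_le_div hpos]; exact hlt.le)
  have hl2 : 0 ≤ Real.log (1 / (1 - gaussCdf q)) :=
    Real.log_nonneg (by rw [one_le_div (by linarith)]; linarith)
  rcases le_total q 0 with hq | hq
  · exact (sum_hessian_sq_le_of_nonpos hg h0 h1 hq hgq hpos).trans (by rw [hlog]; linarith)
  · have h := sum_hessian_sq_le_of_nonpos (g := fun y => 1 - g y) (measurable_const.sub hg)
      (fun y => by linarith [h1 y]) (fun y => by linarith [h0 y]) (neg_nonpos.2 hq)
      (by rw [integral_one_sub hg habs, hgq, gaussCdf_neg]) (by rw [gaussCdf_neg]; linarith)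
    simp only [levelOne_one_sub hg habs, levelTwo_one_sub hg habs, gaussPhi_neg,
      gaussCdf_neg] at h
    refine (le_of_eq ?_).trans (h.trans (by rw [hlog]; linarith))
    refine Finset.sum_congr rfl fun i _ => Finset.sum_congr rfl fun j _ => ?_
    ring

lemma integral_add_eq_zero {n : ℕ} {g : (Fin n → ℝ) → ℝ} (hg : Measurable g)
    (h0 : ∀ y, 0 ≤ g y) (h1 : ∀ y, g y ≤ 1) {b : Fin n → ℝ}
    (hb : ∫ y, g (fun i => y i + b i) ∂(stdGaussian n) = 0) (b' : Fin n → ℝ) :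
    ∫ y, g (fun i => y i + b' i) ∂(stdGaussian n) = 0 := by
  have hd : Integrable (shiftDensity b) (stdGaussian n) := by
    refine Integrable.of_integral_ne_zero ?_
    have := integral_add_stdGaussian b fun _ => (1 : ℝ)
    simp only [integral_const, probReal_univ, mul_one, smul_eq_mul] at this
    rw [← this]
    exact one_ne_zero
  have hi : Integrable (fun y => shiftDensity b y * g y) (stdGaussian n) :=
    hd.mul_bdd (c := 1) hg.aestronglyMeasurable
      (Eventually.of_forall fun y => abs_le.2 ⟨by linarith [h0 y], h1 y⟩)
  rw [integral_add_stdGaussian, integral_eq_zero_iff_of_nonneg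
    (fun y => mul_nonneg (shiftDensity_pos b y).le (h0 y)) hi] at hb
  rw [integral_add_stdGaussian]
  refine integral_eq_zero_of_ae ?_
  filter_upwards [hb] with y hy
  have : g y = 0 := by simpa [(shiftDensity_pos b y).ne'] using hy
  simp [this]

/-- First and second derivatives of `Φ⁻¹ ∘ G`, where `G` is the Gaussian smoothing of `g`. -/
lemma pd2_gaussCdfInv_integral_add {n : ℕ} {g : (Fin n → ℝ) → ℝ} (hg : Measurable g)
    (h1 : ∀ y, |g y| ≤ 1)
    (hG : ∀ b : Fin n → ℝ, ∫ y, g (fun i => y i + b i) ∂(stdGaussian n) ∈ Set.Ioo (0 : ℝ) 1)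
    (b : Fin n → ℝ) (i j : Fin n) {q : ℝ}
    (hq : gaussCdf q = ∫ y, g (fun i => y i + b i) ∂(stdGaussian n)) :
    pd2 i j (fun b => gaussCdfInv (∫ y, g (fun i => y i + b i) ∂(stdGaussian n))) b =
      levelTwo (fun y => g (fun i => y i + b i)) i j / gaussPhi q +
        q * levelOne (fun y => g (fun i => y i + b i)) i *
          levelOne (fun y => g (fun i => y i + b i)) j / gaussPhi q ^ 2 := by
  set G : (Fin n → ℝ) → ℝ := fun b => ∫ y, g (fun i => y i + b i) ∂(stdGaussian n) with hGdef
  have hF : ∀ b, HasFDerivAt (fun b => gaussCdfInv (G b))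
      ((gaussPhi (gaussCdfInv (G b)))⁻¹ • fderiv ℝ G b) b := fun b =>
    (hasDerivAt_gaussCdfInv (hG b).1 (hG b).2).comp_hasFDerivAt b
      (pd_integral_add hg h1 b).1.hasFDerivAt
  have hpd : pd i (fun b => gaussCdfInv (G b)) = fun b =>
      (gaussPhi (gaussCdfInv (G b)))⁻¹ * levelOne (fun y => g (fun i => y i + b i)) i := by
    ext b
    rw [pd, (hF b).fderiv, ← (pd_integral_add hg h1 b).2 i]
    rfl
  have hqb : gaussCdfInv (G b) = q := (congrArg gaussCdfInv hq.symm).trans (gaussCdfInv_gaussCdf q)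
  have hφ := (gaussPhi_pos q).ne'
  obtain ⟨d, hd⟩ := pd_levelOne_add hg h1 i b
  have hinv := ((hasDerivAt_gaussPhi q).inv hφ)
  rw [← hqb] at hinv
  have hprod := (hinv.comp_hasFDerivAt b (hF b)).mul d.hasFDerivAt
  have hj : fderiv ℝ G b (Pi.single j 1) = _ := (pd_integral_add hg h1 b).2 j
  have hdj := hd j
  rw [pd2, hpd, pd]
  erw [hprod.fderiv]
  rw [pd] at hdj
  simp only [_root_.add_apply, _root_.smul_apply, smul_eq_mul, Function.comp_apply, hj, hdj, hqb,
    Pi.inv_apply]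
  field_simp

lemma hessFrob_const {n : ℕ} (c : ℝ) (x : Fin n → ℝ) :
    hessFrob (fun _ : Fin n → ℝ => c) x = 0 := by
  have : ∀ i, pd i (fun _ : Fin n → ℝ => c) = fun _ => 0 := fun i => funext fun b => pd_const i c b
  simp [hessFrob, pd2, this, pd_const]

lemma hessFrob_gaussCdfInv_integral_add_le {n : ℕ} {g : (Fin n → ℝ) → ℝ} (hg : Measurable g)
    (h0 : ∀ y, 0 ≤ g y) (h1 : ∀ y, g y ≤ 1) (b : Fin n → ℝ) :
    hessFrob (fun b => gaussCdfInv (∫ y, g (fun i => y i + b i) ∂(stdGaussian n))) b ≤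
      150 * Real.sqrt (Real.log (1 / ((∫ y, g (fun i => y i + b i) ∂(stdGaussian n)) *
        (1 - ∫ y, g (fun i => y i + b i) ∂(stdGaussian n))))) := by
  have habs : ∀ y, |g y| ≤ 1 := fun y => abs_le.2 ⟨by linarith [h0 y], h1 y⟩
  have hgb : ∀ b : Fin n → ℝ, Measurable fun y : Fin n → ℝ => g (fun i => y i + b i) :=
    fun b => hg.comp (by fun_prop)
  by_cases hG : ∀ b : Fin n → ℝ, ∫ y, g (fun i => y i + b i) ∂(stdGaussian n) ∈ Set.Ioo (0 : ℝ) 1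
  · obtain ⟨q, hq⟩ := exists_gaussCdf_eq (hG b).1 (hG b).2
    have h := sum_hessian_sq_le (hgb b) (fun _ => h0 _) (fun _ => h1 _) hq.symm
      (hq ▸ (hG b).1) (hq ▸ (hG b).2)
    simp only [hessFrob, pd2_gaussCdfInv_integral_add hg habs hG b _ _ hq]
    rw [← hq]
    refine (Real.sqrt_le_sqrt h).trans (le_of_eq ?_)
    rw [Real.sqrt_mul (by norm_num), show (22500 : ℝ) = 150 ^ 2 by norm_num,
      Real.sqrt_sq (by norm_num)]
  · have hconst : ∃ c, ∀ b : Fin n → ℝ, ∫ y, g (fun i => y i + b i) ∂(stdGaussian n) = c := by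
      simp only [not_forall, Set.mem_Ioo, not_and_or, not_lt] at hG
      obtain ⟨b₀, hb | hb⟩ := hG
      · exact ⟨0, integral_add_eq_zero hg h0 h1 (hb.antisymm (integral_nonneg fun _ => h0 _))⟩
      · have hle : ∫ y, g (fun i => y i + b₀ i) ∂(stdGaussian n) ≤ 1 := by
          have := integral_mono (integrable_of_abs_le_one (hgb b₀) fun _ => habs _)
            (integrable_const (1 : ℝ)) fun _ => h1 _
          simpa using this
        have h := integral_add_eq_zero (g := fun y => 1 - g y) (measurable_const.sub hg)
          (fun y => by linarith [h1 y]) (fun y => by linarith [h0 y]) (b := b₀)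
          (by rw [integral_one_sub (hgb b₀) fun _ => habs _]; linarith)
        refine ⟨1, fun b => ?_⟩
        have := h b
        rw [integral_one_sub (hgb b) fun _ => habs _] at this
        linarith
    obtain ⟨c, hc⟩ := hconst
    simp only [hc, hessFrob_const]
    positivity

lemma pd_comp_smul {n : ℕ} (i : Fin n) (F : (Fin n → ℝ) → ℝ) (κ : ℝ) (x : Fin n → ℝ) :
    pd i (fun x => F (κ • x)) x = κ * pd i F (κ • x) := by
  rw [pd, fderiv_comp_smul]
  rfl

lemma pd_const_mul {n : ℕ} (i : Fin n) (F : (Fin n → ℝ) → ℝ) (κ : ℝ) (x : Fin n → ℝ) :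
    pd i (fun x => κ * F x) x = κ * pd i F x := by
  have : fderiv ℝ (fun x => κ * F x) = κ • fderiv ℝ F := fderiv_const_smul_field κ
  rw [pd, this]
  rfl

lemma hessFrob_comp_smul {n : ℕ} (F : (Fin n → ℝ) → ℝ) (κ : ℝ) (x : Fin n → ℝ) :
    hessFrob (fun x => F (κ • x)) x = κ ^ 2 * hessFrob F (κ • x) := by
  have h : ∀ i j, pd2 i j (fun x => F (κ • x)) x = κ ^ 2 * pd2 i j F (κ • x) := fun i j => by
    have e : pd i (fun x => F (κ • x)) = fun x => κ * pd i F (κ • x) :=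
      funext fun x => pd_comp_smul i F κ x
    rw [pd2, e, pd_const_mul, pd_comp_smul, pd2]
    ring
  simp only [hessFrob, h, mul_pow, ← Finset.mul_sum]
  rw [Real.sqrt_mul (by positivity), Real.sqrt_sq (by positivity)]

/-- pointwise Frobenius bound on the Hessian of `h_t = Φ⁻¹(P_t f)`. -/
theorem stmt11 :
    ∃ c : ℝ, 0 < c ∧ ∀ (n : ℕ) (f : (Fin n → ℝ) → ℝ), Measurable f →
      (∀ x, f x ∈ Set.Icc (0 : ℝ) 1) →
      ∀ (t : ℝ), 0 < t → ∀ x : Fin n → ℝ,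
        hessFrob (fun y => gaussCdfInv (OU n t f y)) x
          ≤ c * (Real.exp (-2 * t) / (1 - Real.exp (-2 * t))) *
              Real.sqrt (Real.log (1 / (OU n t f x * (1 - OU n t f x)))) := by
  refine ⟨150, by norm_num, fun n f hf hf01 t ht x => ?_⟩
  have he : 0 < 1 - Real.exp (-2 * t) := by
    have : Real.exp (-2 * t) < 1 := Real.exp_lt_one_iff.2 (by linarith)
    linarith
  set s := Real.sqrt (1 - Real.exp (-2 * t)) with hs
  have hs0 : 0 < s := Real.sqrt_pos.2 he
  set κ := Real.exp (-t) / s with hκ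
  have hκ2 : κ ^ 2 = Real.exp (-2 * t) / (1 - Real.exp (-2 * t)) := by
    rw [hκ, div_pow, hs, Real.sq_sqrt he.le, ← Real.exp_nat_mul]
    congr 2
    push_cast
    ring
  have hOU : ∀ x, OU n t f x =
      ∫ y, (fun z : Fin n → ℝ => f fun i => s * z i) (fun i => y i + (κ • x) i)
        ∂(stdGaussian n) := fun x => by
    rw [OU]
    refine integral_congr_ae (Eventually.of_forall fun y => ?_)
    simp only [Pi.smul_apply, smul_eq_mul, hκ, ← hs]
    congr 1
    ext i
    field_simp
    ring
  have h := hessFrob_gaussCdfInv_integral_add_le (g := fun z : Fin n → ℝ => f fun i => s * z i)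
    (hf.comp (by fun_prop)) (fun _ => (hf01 _).1) (fun _ => (hf01 _).2) (κ • x)
  simp only [hOU]
  rw [hessFrob_comp_smul (fun b => gaussCdfInv
    (∫ y, (fun z : Fin n → ℝ => f fun i => s * z i) (fun i => y i + b i) ∂(stdGaussian n))), hκ2]
  calc _ ≤ _ := mul_le_mul_of_nonneg_left h (by positivity)
    _ = _ := by ring
end

section
/- Anti-concentration of smoothed functions away from indicators: there is an absolute constant c > 0 such that for every measurable f: R^n → [0,1] with E[f] ≤ 1/2, every s > 0, and every measurable set B ⊆ R^n, E[(P_s f - 1_B)²] ≥ c·min{(E[f])², sqrt(s)}·E[f], where expectations are with respect to the standard Gaussian measure. -/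
open MeasureTheory Real Filter
open scoped ENNReal NNReal

instance (n : ℕ) : IsProbabilityMeasure (stdGaussian n) := by
  unfold stdGaussian; infer_instance

lemma isGaussian_stdGaussian (n : ℕ) : ProbabilityTheory.IsGaussian (stdGaussian n) := by
  have h := ProbabilityTheory.map_pi_eq_stdGaussian (ι := Fin n)
  have h2 : stdGaussian n = (ProbabilityTheory.stdGaussian (EuclideanSpace ℝ (Fin n))).map
      (PiLp.continuousLinearEquiv 2 ℝ (fun _ : Fin n => ℝ)) := by
    rw [← h, Measure.map_map (by fun_prop) (by fun_prop)]
    exact (Measure.map_id).symm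
  rw [h2]
  infer_instance

lemma integral_sum_mul_stdGaussian {n : ℕ} (m : Fin n → ℝ) :
    ∫ z, ∑ i, m i * z i ∂(stdGaussian n) = 0 := by
  unfold stdGaussian
  rw [integral_finsetSum]
  · refine Finset.sum_eq_zero fun i _ => ?_
    rw [integral_const_mul, integral_eval]
    rw [ProbabilityTheory.integral_id_gaussianReal, mul_zero]
  · intro i _
    refine (integrable_comp_eval (X := fun _ : Fin n => ℝ) (f := fun t : ℝ => t) ?_).const_mul _
    exact (ProbabilityTheory.memLp_id_gaussianReal' 1 (by simp)).integrable le_rfl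

lemma memLp_sum_mul_stdGaussian {n : ℕ} (m : Fin n → ℝ) :
    MemLp (fun z : Fin n → ℝ => ∑ i, m i * z i) 2 (stdGaussian n) := by
  refine memLp_finsetSum _ fun i _ => MemLp.const_mul ?_ _
  exact (ProbabilityTheory.memLp_id_gaussianReal' 2 (by simp)).comp_measurePreserving
    (measurePreserving_eval _ i)

lemma integral_sq_sum_mul_stdGaussian {n : ℕ} (m : Fin n → ℝ) :
    ∫ z, (∑ i, m i * z i) ^ 2 ∂(stdGaussian n) = ∑ i, m i ^ 2 := by
  have h := ProbabilityTheory.variance_sum_pi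
    (μ := fun _ : Fin n => ProbabilityTheory.gaussianReal 0 1) (X := fun i t => m i * t)
    (fun i => (ProbabilityTheory.memLp_id_gaussianReal' 2 (by simp)).const_mul _)
  have hv (i : Fin n) : ProbabilityTheory.variance (fun t => m i * t)
      (ProbabilityTheory.gaussianReal 0 1) = m i ^ 2 := by
    rw [ProbabilityTheory.variance_const_mul, ProbabilityTheory.variance_fun_id_gaussianReal]
    simp
  rw [Finset.sum_congr rfl fun i _ => hv i,
    ProbabilityTheory.variance_of_integral_eq_zero (by fun_prop)] at h
  · simpa [stdGaussian] using h
  · simpa [stdGaussian] using integral_sum_mul_stdGaussian m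

lemma map_rotation_stdGaussian (n : ℕ) (θ : ℝ) :
    ((stdGaussian n).prod (stdGaussian n)).map (ContinuousLinearMap.rotation θ) =
      (stdGaussian n).prod (stdGaussian n) := by
  have := isGaussian_stdGaussian n
  refine ProbabilityTheory.IsGaussian.map_rotation_eq_self_of_forall_strongDual_eq_zero
    (fun L => ?_) θ
  rw [← integral_sum_mul_stdGaussian fun i => L (Pi.single i 1)]
  congr 1 with z
  conv_lhs => rw [pi_eq_sum_univ' z, map_sum]
  refine Finset.sum_congr rfl fun i _ => ?_
  rw [map_smul, smul_eq_mul, mul_comm]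

lemma gaussianReal_eq_withDensity (b : ℝ) :
    ProbabilityTheory.gaussianReal b 1 = (ProbabilityTheory.gaussianReal 0 1).withDensity
      fun t => ENNReal.ofReal (exp (b * t - b ^ 2 / 2)) := by
  rw [ProbabilityTheory.gaussianReal_of_var_ne_zero _ one_ne_zero,
    ProbabilityTheory.gaussianReal_of_var_ne_zero _ one_ne_zero,
    ← withDensity_mul _ (by fun_prop) (by fun_prop)]
  congr 1 with t
  simp only [Pi.mul_apply, ProbabilityTheory.gaussianPDF]
  rw [← ENNReal.ofReal_mul (ProbabilityTheory.gaussianPDFReal_nonneg _ _ _)]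
  simp only [ProbabilityTheory.gaussianPDFReal]
  rw [mul_assoc _ (rexp _), ← exp_add]
  congr 3
  simp
  ring

lemma integrable_exp_mul_abs_gaussianReal (c : ℝ) :
    Integrable (fun t => exp (c * |t|)) (ProbabilityTheory.gaussianReal 0 1) :=
  ProbabilityTheory.integrable_exp_mul_abs
    (ProbabilityTheory.integrable_exp_mul_gaussianReal c)
    (ProbabilityTheory.integrable_exp_mul_gaussianReal (-c))

lemma integrable_exp_sum_mul_abs {n : ℕ} (c : Fin n → ℝ) :
    Integrable (fun z => exp (∑ i, c i * |z i|)) (stdGaussian n) := by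
  simp_rw [exp_sum]
  exact Integrable.fintype_prod (f := fun i (t : ℝ) => exp (c i * |t|))
    fun i => integrable_exp_mul_abs_gaussianReal (c i)

/-- The Cameron-Martin formula. -/
lemma map_add_stdGaussian {n : ℕ} (b : Fin n → ℝ) :
    (stdGaussian n).map (fun z => z + b) = (stdGaussian n).withDensity
      fun z => ENNReal.ofReal (exp (∑ i, (b i * z i - b i ^ 2 / 2))) := by
  have h1 : (stdGaussian n).map (fun z => z + b) =
      Measure.pi fun i => ProbabilityTheory.gaussianReal (b i) 1 := by
    have := Measure.pi_map_pi (μ := fun _ : Fin n => ProbabilityTheory.gaussianReal 0 1)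
      (f := fun i t => t + b i) (fun i => by fun_prop)
    simp_rw [ProbabilityTheory.gaussianReal_map_add_const, zero_add] at this
    rw [← this]
    rfl
  rw [h1]
  have hi (i : Fin n) : Integrable (fun t => exp (b i * t - b i ^ 2 / 2))
      (ProbabilityTheory.gaussianReal 0 1) := by
    simp_rw [exp_sub, div_eq_mul_inv]
    exact (ProbabilityTheory.integrable_exp_mul_gaussianReal _).mul_const _
  refine Measure.pi_eq fun s hs => ?_
  rw [withDensity_apply _ (MeasurableSet.univ_pi hs)]
  have h2 : ∫⁻ z in Set.univ.pi s, ENNReal.ofReal (exp (∑ i, (b i * z i - b i ^ 2 / 2)))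
        ∂(stdGaussian n) =
      ENNReal.ofReal (∫ z, ∏ i, exp (b i * z i - b i ^ 2 / 2) ∂(Measure.pi fun i =>
        (ProbabilityTheory.gaussianReal 0 1).restrict (s i))) := by
    rw [stdGaussian, Measure.restrict_pi_pi, ofReal_integral_eq_lintegral_ofReal]
    · simp_rw [exp_sum]
    · exact Integrable.fintype_prod (f := fun i (t : ℝ) => exp (b i * t - b i ^ 2 / 2))
        fun i => (hi i).restrict
    · exact ae_of_all _ fun z => by positivity
  rw [h2, integral_fintype_prod_eq_prod (f := fun i (t : ℝ) => exp (b i * t - b i ^ 2 / 2)),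
    ENNReal.ofReal_prod_of_nonneg fun i _ => by positivity]
  refine Finset.prod_congr rfl fun i _ => ?_
  rw [gaussianReal_eq_withDensity (b i), withDensity_apply _ (hs i),
    ofReal_integral_eq_lintegral_ofReal (hi i).restrict (ae_of_all _ fun z => by positivity)]

lemma integral_add_stdGaussian_s16 {n : ℕ} (b : Fin n → ℝ) (F : (Fin n → ℝ) → ℝ) :
    ∫ z, F (z + b) ∂(stdGaussian n) =
      ∫ z, exp (∑ i, (b i * z i - b i ^ 2 / 2)) * F z ∂(stdGaussian n) := by
  have h : ∫ z, F (z + b) ∂(stdGaussian n) = ∫ z, F z ∂((stdGaussian n).map (fun z => z + b)) :=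
    ((MeasurableEquiv.addRight b).measurableEmbedding.integral_map F).symm
  rw [h, map_add_stdGaussian, integral_withDensity_eq_integral_toReal_smul (by fun_prop)
    (ae_of_all _ fun _ => ENNReal.ofReal_lt_top)]
  congr 1 with z
  rw [ENNReal.toReal_ofReal (exp_pos _).le, smul_eq_mul]

lemma sum_sq_integral_mul_le {n : ℕ} {F : (Fin n → ℝ) → ℝ} (hF : Measurable F)
    (hF1 : ∀ z, |F z| ≤ 1) :
    ∑ i, (∫ z, F z * z i ∂(stdGaussian n)) ^ 2 ≤ 1 := by
  set m : Fin n → ℝ := fun i => ∫ z, F z * z i ∂(stdGaussian n) with hm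
  have hint (i : Fin n) : Integrable (fun z => F z * z i) (stdGaussian n) := by
    have h := memLp_sum_mul_stdGaussian (n := n) (Pi.single i 1)
    simp only [Pi.single_apply, ite_mul, one_mul, zero_mul, Finset.sum_ite_eq',
      Finset.mem_univ, if_true] at h
    exact (h.integrable (by norm_num)).bdd_mul hF.aestronglyMeasurable (ae_of_all _ hF1)
  have h1 : ∑ i, m i ^ 2 = ∫ z, F z * ∑ i, m i * z i ∂(stdGaussian n) := by
    simp_rw [Finset.mul_sum, mul_left_comm (F _)]
    rw [integral_finsetSum _ fun i _ => (hint i).const_mul _]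
    simp_rw [integral_const_mul, sq, hm]
  have h2 : ∫ z, F z * ∑ i, m i * z i ∂(stdGaussian n) ≤
      ∫ z, (1 / 2 + (∑ i, m i * z i) ^ 2 / 2) ∂(stdGaussian n) := by
    refine integral_mono ?_ ((integrable_const _).add
      ((memLp_sum_mul_stdGaussian m).integrable_sq.div_const _)) fun z => ?_
    · exact ((memLp_sum_mul_stdGaussian m).integrable (by norm_num)).bdd_mul
        hF.aestronglyMeasurable (ae_of_all _ hF1)
    · nlinarith [sq_nonneg (F z - ∑ i, m i * z i), sq_abs (F z), abs_nonneg (F z), hF1 z]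
  rw [integral_add (integrable_const _) ((memLp_sum_mul_stdGaussian m).integrable_sq.div_const _),
    integral_div _ fun z : Fin n → ℝ => (∑ i, m i * z i) ^ 2, integral_sq_sum_mul_stdGaussian] at h2
  simp at h2
  change ∑ i, m i ^ 2 ≤ 1
  linarith

/-- The average of `f (β x + σ z)` over a standard Gaussian `z`. -/
noncomputable def gaussAvg {n : ℕ} (β σ : ℝ) (f : (Fin n → ℝ) → ℝ) (x : Fin n → ℝ) : ℝ :=
  ∫ z, f (fun i => β * x i + σ * z i) ∂(stdGaussian n)

/-- The derivative of `gaussAvg β σ f` at `x` in the direction `w`. -/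
noncomputable def gaussAvgDeriv {n : ℕ} (β σ : ℝ) (f : (Fin n → ℝ) → ℝ) (x w : Fin n → ℝ) : ℝ :=
  β / σ * ∫ z, f (fun i => β * x i + σ * z i) * ∑ i, w i * z i ∂(stdGaussian n)

section GaussAvg

variable {n : ℕ} {β σ : ℝ} {f : (Fin n → ℝ) → ℝ}

lemma measurable_gaussAvg (hf : Measurable f) : Measurable (gaussAvg β σ f) := by
  unfold gaussAvg
  refine (StronglyMeasurable.integral_prod_right' (ν := stdGaussian n)
    (f := fun p : (Fin n → ℝ) × (Fin n → ℝ) => f fun i => β * p.1 i + σ * p.2 i) ?_).measurable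
  exact (hf.comp (by fun_prop)).stronglyMeasurable

lemma measurable_gaussAvgDeriv (hf : Measurable f) :
    Measurable fun p : (Fin n → ℝ) × (Fin n → ℝ) => gaussAvgDeriv β σ f p.1 p.2 := by
  unfold gaussAvgDeriv
  refine (StronglyMeasurable.integral_prod_right' (ν := stdGaussian n)
    (f := fun p : ((Fin n → ℝ) × (Fin n → ℝ)) × (Fin n → ℝ) =>
      f (fun i => β * p.1.1 i + σ * p.2 i) * ∑ i, p.1.2 i * p.2 i) ?_).measurable.const_mul _
  exact ((hf.comp (by fun_prop)).mul (by fun_prop)).stronglyMeasurable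

lemma gaussAvg_mem_Icc (hf : Measurable f) (hf1 : ∀ x, f x ∈ Set.Icc (0 : ℝ) 1) (x : Fin n → ℝ) :
    gaussAvg β σ f x ∈ Set.Icc (0 : ℝ) 1 := by
  refine ⟨integral_nonneg fun z => (hf1 _).1, ?_⟩
  have := integral_mono (μ := stdGaussian n) (f := fun z => f (fun i => β * x i + σ * z i))
    (g := fun _ => 1) ?_ (integrable_const _) fun z => (hf1 _).2
  · simpa [gaussAvg] using this
  · exact Integrable.of_mem_Icc 0 1 (hf.comp (by fun_prop)).aemeasurable (ae_of_all _ fun z => hf1 _)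

lemma integrable_mul_sum_mul (hf : Measurable f) (hf1 : ∀ x, f x ∈ Set.Icc (0 : ℝ) 1)
    (x w : Fin n → ℝ) : Integrable
      (fun z => f (fun i => β * x i + σ * z i) * ∑ i, w i * z i) (stdGaussian n) := by
  refine ((memLp_sum_mul_stdGaussian w).integrable (by norm_num)).bdd_mul (c := 1)
    (hf.comp (by fun_prop)).aestronglyMeasurable (ae_of_all _ fun z => ?_)
  rw [Real.norm_eq_abs, abs_of_nonneg (hf1 _).1]
  exact (hf1 _).2

lemma gaussAvgDeriv_eq_sum (hf : Measurable f) (hf1 : ∀ x, f x ∈ Set.Icc (0 : ℝ) 1)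
    (x w : Fin n → ℝ) : gaussAvgDeriv β σ f x w = β / σ *
      ∑ i, (∫ z, f (fun i => β * x i + σ * z i) * z i ∂(stdGaussian n)) * w i := by
  unfold gaussAvgDeriv
  congr 1
  simp_rw [Finset.mul_sum, ← mul_assoc, mul_right_comm _ (w _)]
  rw [integral_finsetSum]
  · simp_rw [integral_mul_const]
  · intro i _
    have := integrable_mul_sum_mul (β := β) (σ := σ) hf hf1 x (Pi.single i 1)
    simp only [Pi.single_apply, ite_mul, one_mul, zero_mul, Finset.sum_ite_eq',
      Finset.mem_univ, if_true] at this
    exact this.mul_const _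

lemma lintegral_gaussAvgDeriv_le (hf : Measurable f) (hf1 : ∀ x, f x ∈ Set.Icc (0 : ℝ) 1)
    (hβ : 0 ≤ β) (hσ : 0 ≤ σ) (x : Fin n → ℝ) :
    ∫⁻ w, ‖gaussAvgDeriv β σ f x w‖ₑ ∂(stdGaussian n) ≤ ENNReal.ofReal (β / σ) := by
  set m : Fin n → ℝ := fun i => ∫ z, f (fun i => β * x i + σ * z i) * z i ∂(stdGaussian n)
  have hm : ∑ i, m i ^ 2 ≤ 1 := sum_sq_integral_mul_le (hf.comp (by fun_prop)) fun z => by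
    rw [abs_of_nonneg (hf1 _).1]
    exact (hf1 _).2
  have hint : Integrable (fun w => β / σ * ((1 + (∑ i, m i * w i) ^ 2) / 2)) (stdGaussian n) :=
    (((integrable_const _).add (memLp_sum_mul_stdGaussian m).integrable_sq).div_const _).const_mul _
  have h0 : 0 ≤ β / σ := by positivity
  calc ∫⁻ w, ‖gaussAvgDeriv β σ f x w‖ₑ ∂(stdGaussian n)
      ≤ ∫⁻ w, ENNReal.ofReal (β / σ * ((1 + (∑ i, m i * w i) ^ 2) / 2)) ∂(stdGaussian n) := by
        refine lintegral_mono fun w => ?_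
        rw [gaussAvgDeriv_eq_sum hf hf1, ← ofReal_norm, norm_mul, Real.norm_of_nonneg h0]
        refine ENNReal.ofReal_le_ofReal (mul_le_mul_of_nonneg_left ?_ h0)
        rw [Real.norm_eq_abs, ← sq_abs]
        nlinarith [sq_nonneg (|∑ i, m i * w i| - 1)]
    _ = ENNReal.ofReal (∫ w, β / σ * ((1 + (∑ i, m i * w i) ^ 2) / 2) ∂(stdGaussian n)) :=
        (ofReal_integral_eq_lintegral_ofReal hint (ae_of_all _ fun w => by positivity)).symm
    _ ≤ ENNReal.ofReal (β / σ) := by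
        refine ENNReal.ofReal_le_ofReal ?_
        rw [integral_const_mul, integral_div, integral_add (integrable_const _)
          (memLp_sum_mul_stdGaussian m).integrable_sq, integral_sq_sum_mul_stdGaussian]
        refine mul_le_of_le_one_right h0 ?_
        simp
        linarith

lemma abs_mul_add_mul_le_of_abs_le_one {c s x y : ℝ} (hc : |c| ≤ 1) (hs : |s| ≤ 1) :
    |c * x + s * y| ≤ |x| + |y| := by
  refine (abs_add_le _ _).trans (add_le_add ?_ ?_) <;> rw [abs_mul]
  · exact mul_le_of_le_one_left (abs_nonneg _) hc
  · exact mul_le_of_le_one_left (abs_nonneg _) hs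

lemma hasDerivAt_gaussAvg (hf : Measurable f) (hf1 : ∀ x, f x ∈ Set.Icc (0 : ℝ) 1)
    (hβ : 0 ≤ β) (hσ : 0 < σ) (x y : Fin n → ℝ) (θ : ℝ) :
    HasDerivAt (fun θ : ℝ => gaussAvg β σ f (cos θ • x + sin θ • y))
      (gaussAvgDeriv β σ f (cos θ • x + sin θ • y) (-sin θ • x + cos θ • y)) θ := by
  set a := β / σ with ha
  have ha0 : 0 ≤ a := by positivity
  have hβa : β = σ * a := by rw [ha]; field_simp
  set v : ℝ → Fin n → ℝ := fun t => cos t • x + sin t • y with hv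
  set v' : ℝ → Fin n → ℝ := fun t => -sin t • x + cos t • y with hv'
  set r : Fin n → ℝ := fun i => |x i| + |y i| with hr
  have hvr (t : ℝ) (i : Fin n) : |v t i| ≤ r i := by
    simpa [hv] using abs_mul_add_mul_le_of_abs_le_one (abs_cos_le_one t) (abs_sin_le_one t)
  have hv'r (t : ℝ) (i : Fin n) : |v' t i| ≤ r i := by
    simpa [hv'] using abs_mul_add_mul_le_of_abs_le_one (c := -sin t)
      (by rw [abs_neg]; exact abs_sin_le_one t) (abs_cos_le_one t)
  have hvd (t : ℝ) (i : Fin n) : HasDerivAt (fun t => v t i) (v' t i) t := by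
    simpa [hv, hv'] using ((hasDerivAt_cos t).mul_const (x i)).fun_add
      ((hasDerivAt_sin t).mul_const (y i))
  have hrep (t : ℝ) : gaussAvg β σ f (v t) =
      ∫ z, exp (∑ i, (a * v t i * z i - (a * v t i) ^ 2 / 2)) * f (fun i => σ * z i)
        ∂(stdGaussian n) := by
    rw [← integral_add_stdGaussian_s16 (fun i => a * v t i) fun z => f (fun i => σ * z i)]
    unfold gaussAvg
    congr 1 with z
    congr 1 with i
    rw [Pi.add_apply, hβa]
    ring
  have hrep' : gaussAvgDeriv β σ f (v θ) (v' θ) =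
      ∫ z, exp (∑ i, (a * v θ i * z i - (a * v θ i) ^ 2 / 2)) *
        ((∑ i, a * v' θ i * (z i - a * v θ i)) * f (fun i => σ * z i)) ∂(stdGaussian n) := by
    rw [← integral_add_stdGaussian_s16 (fun i => a * v θ i)
      fun z => (∑ i, a * v' θ i * (z i - a * v θ i)) * f (fun i => σ * z i)]
    unfold gaussAvgDeriv
    rw [← integral_const_mul]
    congr 1 with z
    simp only [Pi.add_apply, add_sub_cancel_right]
    rw [mul_left_comm, mul_comm, Finset.mul_sum]
    congr 1
    · simp_rw [ha, mul_assoc]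
    · congr 1 with i
      rw [hβa]
      ring
  set S : (Fin n → ℝ) → ℝ := fun z => ∑ i, a * r i * |z i| with hS
  set C : ℝ := ∑ i, (a * r i) ^ 2 with hC
  have hC0 : 0 ≤ C := by positivity
  have hE (t : ℝ) (z : Fin n → ℝ) :
      exp (∑ i, (a * v t i * z i - (a * v t i) ^ 2 / 2)) ≤ exp (S z) := by
    refine exp_le_exp.2 (Finset.sum_le_sum fun i _ => ?_)
    have h1 : a * v t i * z i ≤ a * r i * |z i| := by
      refine (le_abs_self _).trans ?_
      rw [abs_mul, abs_mul, abs_of_nonneg ha0]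
      gcongr
      exact hvr t i
    nlinarith [sq_nonneg (a * v t i)]
  have hf' (z : Fin n → ℝ) : |f z| ≤ 1 := by
    rw [abs_of_nonneg (hf1 _).1]
    exact (hf1 _).2
  have hint2 : Integrable (fun z => (1 + C) * exp (∑ i, 2 * (a * r i) * |z i|)) (stdGaussian n) :=
    (integrable_exp_sum_mul_abs _).const_mul _
  have hfm : Measurable fun z : Fin n → ℝ => f fun i => σ * z i := hf.comp (by fun_prop)
  have key := hasDerivAt_integral_of_dominated_loc_of_deriv_le (μ := stdGaussian n) (x₀ := θ)
    (F := fun t z => exp (∑ i, (a * v t i * z i - (a * v t i) ^ 2 / 2)) * f (fun i => σ * z i))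
    (F' := fun t z => exp (∑ i, (a * v t i * z i - (a * v t i) ^ 2 / 2)) *
        ((∑ i, a * v' t i * (z i - a * v t i)) * f (fun i => σ * z i)))
    (bound := fun z => (1 + C) * exp (∑ i, 2 * (a * r i) * |z i|))
    Filter.univ_mem ?_ ?_ ?_ ?_ hint2 ?_
  · exact (key.2.congr_of_eventuallyEq (Eventually.of_forall hrep)).congr_deriv hrep'.symm
  · refine Eventually.of_forall fun t => ?_
    exact ((by fun_prop : Measurable fun z : Fin n → ℝ =>
      exp (∑ i, (a * v t i * z i - (a * v t i) ^ 2 / 2))).mul hfm).aestronglyMeasurable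
  · refine (integrable_exp_sum_mul_abs fun i => a * r i).mono' ?_ (ae_of_all _ fun z => ?_)
    · exact ((by fun_prop : Measurable fun z : Fin n → ℝ =>
        exp (∑ i, (a * v θ i * z i - (a * v θ i) ^ 2 / 2))).mul hfm).aestronglyMeasurable
    · rw [norm_mul, Real.norm_of_nonneg (exp_pos _).le]
      exact (mul_le_of_le_one_right (exp_pos _).le (hf' _)).trans (hE θ z)
  · exact ((by fun_prop : Measurable fun z : Fin n → ℝ =>
      exp (∑ i, (a * v θ i * z i - (a * v θ i) ^ 2 / 2))).mul
      ((by fun_prop : Measurable fun z : Fin n → ℝ =>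
        ∑ i, a * v' θ i * (z i - a * v θ i)).mul hfm)).aestronglyMeasurable
  · refine ae_of_all _ fun z t _ => ?_
    have h1 : |∑ i, a * v' t i * (z i - a * v t i)| ≤ S z + C := by
      rw [hS, hC, ← Finset.sum_add_distrib]
      refine (Finset.abs_sum_le_sum_abs _ _).trans (Finset.sum_le_sum fun i _ => ?_)
      rw [abs_mul, abs_mul, abs_of_nonneg ha0]
      have h2 : |z i - a * v t i| ≤ |z i| + a * r i := by
        refine (abs_sub _ _).trans ?_
        rw [abs_mul, abs_of_nonneg ha0]
        gcongr
        exact hvr t i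
      calc a * |v' t i| * |z i - a * v t i| ≤ a * r i * (|z i| + a * r i) := by
            gcongr
            exact hv'r t i
        _ = _ := by ring
    have h3 : S z + C ≤ (1 + C) * exp (S z) := by
      have h4 := add_one_le_exp (S z)
      have h5 : 0 ≤ S z := by positivity
      nlinarith
    have h6 : exp (∑ i, 2 * (a * r i) * |z i|) = exp (S z) * exp (S z) := by
      rw [← exp_add, hS, ← Finset.sum_add_distrib]
      congr 2 with i
      ring
    rw [norm_mul, norm_mul, Real.norm_of_nonneg (exp_pos _).le, Real.norm_eq_abs,
      Real.norm_eq_abs, h6]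
    calc _ ≤ exp (S z) * ((S z + C) * 1) :=
          mul_le_mul (hE t z) (mul_le_mul h1 (hf' _) (abs_nonneg _) ((abs_nonneg _).trans h1))
            (by positivity) (exp_pos _).le
      _ ≤ exp (S z) * ((1 + C) * exp (S z)) := by
          rw [mul_one]
          gcongr
      _ = _ := by ring
  · refine ae_of_all _ fun z t _ => ?_
    have h1 : HasDerivAt (fun t => ∑ i, (a * v t i * z i - (a * v t i) ^ 2 / 2))
        (∑ i, a * v' t i * (z i - a * v t i)) t := by
      refine HasDerivAt.fun_sum fun i _ => ?_
      have h2 := (hvd t i).const_mul a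
      have h3 := (h2.mul_const (z i)).fun_sub ((h2.fun_pow 2).div_const 2)
      refine h3.congr_deriv ?_
      push_cast
      ring
    exact (h1.exp.mul_const (f fun i => σ * z i)).congr_deriv (mul_assoc _ _ _)

end GaussAvg

/-- The primitive of `t ^ 2 * (1 - t) ^ 2` vanishing at `0`. -/
noncomputable def quinticRamp (t : ℝ) : ℝ := t ^ 3 / 3 - t ^ 4 / 2 + t ^ 5 / 5

lemma hasDerivAt_quinticRamp (t : ℝ) : HasDerivAt quinticRamp (t ^ 2 * (1 - t) ^ 2) t := by
  have h := (((hasDerivAt_id' t).fun_pow 3).div_const 3).fun_sub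
    (((hasDerivAt_id' t).fun_pow 4).div_const 2) |>.fun_add
    (((hasDerivAt_id' t).fun_pow 5).div_const 5)
  refine h.congr_deriv ?_
  push_cast
  ring

lemma monotone_quinticRamp : Monotone quinticRamp :=
  monotone_of_hasDerivAt_nonneg hasDerivAt_quinticRamp fun t => by
    simp only [Pi.zero_apply]; positivity

lemma le_quinticRamp_sub {u v : ℝ} (hu : u ≤ 1 / 4) (hv : 3 / 4 ≤ v) :
    1 / 40 ≤ quinticRamp v - quinticRamp u := by
  have h1 := monotone_quinticRamp hu
  have h2 := monotone_quinticRamp hv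
  have h3 : 1 / 40 ≤ quinticRamp (3 / 4) - quinticRamp (1 / 4) := by
    norm_num [quinticRamp]
  linarith

section GaussAvg

variable {n : ℕ} {β σ : ℝ} {f : (Fin n → ℝ) → ℝ}

lemma enorm_quinticRamp_sub_le (hf : Measurable f) (hf1 : ∀ x, f x ∈ Set.Icc (0 : ℝ) 1)
    (hβ : 0 ≤ β) (hσ : 0 < σ) (p : (Fin n → ℝ) × (Fin n → ℝ)) :
    ‖quinticRamp (gaussAvg β σ f p.2) - quinticRamp (gaussAvg β σ f p.1)‖ₑ ≤
      ∫⁻ θ in Set.Ioc 0 (π / 2), ‖(gaussAvg β σ f (ContinuousLinearMap.rotation θ p).1 ^ 2 *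
        (1 - gaussAvg β σ f (ContinuousLinearMap.rotation θ p).1) ^ 2) *
        gaussAvgDeriv β σ f (ContinuousLinearMap.rotation θ p).1
          (ContinuousLinearMap.rotation θ p).2‖ₑ := by
  simp only [ContinuousLinearMap.rotation_apply]
  set x := p.1
  set y := p.2
  set v : ℝ → Fin n → ℝ := fun t => cos t • x + sin t • y with hv
  set v' : ℝ → Fin n → ℝ := fun t => -sin t • x + cos t • y with hv'
  set F' : ℝ → ℝ := fun t => (gaussAvg β σ f (v t) ^ 2 * (1 - gaussAvg β σ f (v t)) ^ 2) *
    gaussAvgDeriv β σ f (v t) (v' t) with hF'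
  have hvm : Measurable v := by fun_prop
  have hv'm : Measurable v' := by fun_prop
  have hGm : Measurable fun t => gaussAvg β σ f (v t) := (measurable_gaussAvg hf).comp hvm
  have hm : Measurable F' :=
    ((hGm.pow_const 2).mul ((measurable_const.sub hGm).pow_const 2)).mul
      ((measurable_gaussAvgDeriv hf).comp (hvm.prodMk hv'm))
  have hpi : (0 : ℝ) ≤ π / 2 := by positivity
  change _ ≤ ∫⁻ θ in Set.Ioc 0 (π / 2), ‖F' θ‖ₑ
  by_cases htop : ∫⁻ θ in Set.Ioc 0 (π / 2), ‖F' θ‖ₑ = ⊤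
  · rw [htop]; exact le_top
  have hint : IntervalIntegrable F' volume 0 (π / 2) := by
    rw [intervalIntegrable_iff_integrableOn_Ioc_of_le hpi]
    exact ⟨hm.aestronglyMeasurable, lt_top_iff_ne_top.2 htop⟩
  have hftc := intervalIntegral.integral_eq_sub_of_hasDerivAt
    (f := fun t => quinticRamp (gaussAvg β σ f (v t)))
    (fun t _ => (hasDerivAt_quinticRamp _).comp t (hasDerivAt_gaussAvg hf hf1 hβ hσ x y t)) hint
  have hv0 : v 0 = x := by simp [hv]
  have hv1 : v (π / 2) = y := by simp [hv]
  rw [hv0, hv1] at hftc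
  rw [← hftc, intervalIntegral.integral_of_le hpi]
  exact enorm_integral_le_lintegral_enorm _

/-- An `L¹` Poincaré inequality for `quinticRamp ∘ gaussAvg β σ f`. -/
lemma lintegral_enorm_quinticRamp_sub_le (hf : Measurable f)
    (hf1 : ∀ x, f x ∈ Set.Icc (0 : ℝ) 1) (hβ : 0 ≤ β) (hσ : 0 < σ) :
    ∫⁻ p, ‖quinticRamp (gaussAvg β σ f p.2) - quinticRamp (gaussAvg β σ f p.1)‖ₑ
        ∂((stdGaussian n).prod (stdGaussian n)) ≤
      ENNReal.ofReal (π / 2) * (ENNReal.ofReal (β / σ) *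
        ∫⁻ x, ENNReal.ofReal (gaussAvg β σ f x ^ 2 * (1 - gaussAvg β σ f x) ^ 2)
          ∂(stdGaussian n)) := by
  set H : (Fin n → ℝ) × (Fin n → ℝ) → ℝ≥0∞ := fun q =>
    ‖(gaussAvg β σ f q.1 ^ 2 * (1 - gaussAvg β σ f q.1) ^ 2) *
      gaussAvgDeriv β σ f q.1 q.2‖ₑ with hH
  have hGm : Measurable (gaussAvg β σ f) := measurable_gaussAvg hf
  have hkm : Measurable fun x => gaussAvg β σ f x ^ 2 * (1 - gaussAvg β σ f x) ^ 2 :=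
    (hGm.pow_const 2).mul ((measurable_const.sub hGm).pow_const 2)
  have hHm : Measurable H :=
    ((hkm.comp measurable_fst).mul (measurable_gaussAvgDeriv hf)).enorm
  have hrot : Measurable fun q : ((Fin n → ℝ) × (Fin n → ℝ)) × ℝ =>
      ContinuousLinearMap.rotation q.2 q.1 := by
    simp only [ContinuousLinearMap.rotation_apply]
    fun_prop
  calc _ ≤ ∫⁻ p, (∫⁻ θ in Set.Ioc 0 (π / 2), H (ContinuousLinearMap.rotation θ p))
        ∂((stdGaussian n).prod (stdGaussian n)) :=
        lintegral_mono fun p => enorm_quinticRamp_sub_le hf hf1 hβ hσ p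
    _ = ∫⁻ θ in Set.Ioc 0 (π / 2), ∫⁻ p, H (ContinuousLinearMap.rotation θ p)
        ∂((stdGaussian n).prod (stdGaussian n)) :=
        lintegral_lintegral_swap
          (f := fun p θ => H (ContinuousLinearMap.rotation θ p)) (hHm.comp hrot).aemeasurable
    _ = ∫⁻ θ in Set.Ioc 0 (π / 2), ∫⁻ p, H p ∂((stdGaussian n).prod (stdGaussian n)) := by
        congr 1 with θ
        conv_rhs => rw [← map_rotation_stdGaussian n θ]
        rw [lintegral_map hHm (by fun_prop)]
    _ = ENNReal.ofReal (π / 2) * ∫⁻ p, H p ∂((stdGaussian n).prod (stdGaussian n)) := by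
        rw [lintegral_const, mul_comm]
        simp
    _ ≤ _ := by
        gcongr
        rw [lintegral_prod _ hHm.aemeasurable, ← lintegral_const_mul _ hkm.ennreal_ofReal]
        refine lintegral_mono fun x => ?_
        simp only [hH, enorm_mul _ (gaussAvgDeriv _ _ _ _ _)]
        rw [lintegral_const_mul' _ _ enorm_ne_top, mul_comm, Real.enorm_of_nonneg (by positivity)]
        gcongr
        exact lintegral_gaussAvgDeriv_le hf hf1 hβ hσ.le x

lemma integral_gaussAvg (hf : Measurable f) (hf1 : ∀ x, f x ∈ Set.Icc (0 : ℝ) 1)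
    (hβ : 0 ≤ β) (hβ1 : β ≤ 1) (hσ : σ = √(1 - β ^ 2)) :
    ∫ x, gaussAvg β σ f x ∂(stdGaussian n) = ∫ x, f x ∂(stdGaussian n) := by
  have h1 : ∫ p, f p.1 ∂((stdGaussian n).prod (stdGaussian n)) = ∫ x, f x ∂(stdGaussian n) := by
    rw [integral_fun_fst]
    simp
  rw [← h1]
  conv_rhs => rw [← map_rotation_stdGaussian n (arccos β)]
  rw [integral_map (f := fun p : (Fin n → ℝ) × (Fin n → ℝ) => f p.1) (by fun_prop)
    (hf.comp measurable_fst).aestronglyMeasurable, integral_prod]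
  · simp only [ContinuousLinearMap.rotation_apply, cos_arccos (by linarith) hβ1, sin_arccos, ← hσ]
    rfl
  · exact Integrable.of_mem_Icc 0 1
      ((hf.comp measurable_fst).comp (by fun_prop)).aemeasurable (ae_of_all _ fun z => hf1 _)

lemma le_integral_gaussAvg_sq_mul_sq (hf : Measurable f) (hf1 : ∀ x, f x ∈ Set.Icc (0 : ℝ) 1)
    (hβ : 0 ≤ β) (hσ : 0 < σ) (hp : ∫ x, gaussAvg β σ f x ∂(stdGaussian n) ≤ 1 / 2)
    {D : ℝ} (hD : D = ∫ x, gaussAvg β σ f x ^ 2 * (1 - gaussAvg β σ f x) ^ 2 ∂(stdGaussian n))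
    (hD1 : D < (∫ x, gaussAvg β σ f x ∂(stdGaussian n)) ^ 2 / 32) :
    ∫ x, gaussAvg β σ f x ∂(stdGaussian n) ≤ 640 * π * (β / σ * D) := by
  set p := ∫ x, gaussAvg β σ f x ∂(stdGaussian n) with hpdef
  set G := gaussAvg β σ f with hG
  have hGm : Measurable G := measurable_gaussAvg hf
  have hG1 (x) : G x ∈ Set.Icc (0 : ℝ) 1 := gaussAvg_mem_Icc hf hf1 x
  have hGi : Integrable G (stdGaussian n) :=
    Integrable.of_mem_Icc 0 1 hGm.aemeasurable (ae_of_all _ hG1)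
  have hkm : Measurable fun x => G x ^ 2 * (1 - G x) ^ 2 :=
    (hGm.pow_const 2).mul ((measurable_const.sub hGm).pow_const 2)
  have hki : Integrable (fun x => G x ^ 2 * (1 - G x) ^ 2) (stdGaussian n) := by
    refine Integrable.of_mem_Icc 0 1 hkm.aemeasurable (ae_of_all _ fun x => ⟨by positivity, ?_⟩)
    have := hG1 x
    exact mul_le_one₀ (pow_le_one₀ this.1 this.2) (by positivity)
      (pow_le_one₀ (by linarith [this.2]) (by linarith [this.1]))
  have hp0 : 0 ≤ p := integral_nonneg fun x => (hG1 x).1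
  have hp1 : 0 < p := by
    rcases hp0.lt_or_eq with h | h
    · exact h
    · have : 0 ≤ D := hD ▸ integral_nonneg fun x => by positivity
      rw [← h] at hD1
      linarith
  set U : Set (Fin n → ℝ) := {x | 3 / 4 ≤ G x} with hU
  set L : Set (Fin n → ℝ) := {x | G x ≤ 1 / 4} with hL
  have hUm : MeasurableSet U := measurableSet_le measurable_const hGm
  have hLm : MeasurableSet L := measurableSet_le hGm measurable_const
  have hUp : p / 4 ≤ (stdGaussian n).real U := by
    have hi : Integrable (U.indicator fun _ => (1 : ℝ)) (stdGaussian n) :=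
      (integrable_const 1).indicator hUm
    have hi2 : Integrable (fun x => p * U.indicator (fun _ => (1 : ℝ)) x + p ^ 2 / 2)
        (stdGaussian n) := (hi.const_mul p).add (integrable_const _)
    have h := integral_mono (μ := stdGaussian n) (f := fun x => p * G x)
      (g := fun x => (p * U.indicator (fun _ => (1 : ℝ)) x + p ^ 2 / 2) +
        8 * (G x ^ 2 * (1 - G x) ^ 2)) (hGi.const_mul p)
      (hi2.add (hki.const_mul 8)) fun x => by
        obtain ⟨h0, h1⟩ := hG1 x
        by_cases hx : x ∈ U
        · simp only [Set.indicator_of_mem hx]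
          nlinarith [mul_le_of_le_one_right hp0 h1, sq_nonneg (G x * (1 - G x)), sq_nonneg p]
        · simp only [Set.indicator_of_notMem hx]
          have hx' : G x < 3 / 4 := not_le.1 hx
          have h2 : 1 / 16 ≤ (1 - G x) ^ 2 := by nlinarith
          nlinarith [mul_le_mul_of_nonneg_left h2 (sq_nonneg (G x)), sq_nonneg (p - G x)]
    rw [integral_add hi2 (hki.const_mul 8),
      integral_add (hi.const_mul p) (integrable_const _), integral_const_mul, integral_const_mul,
      integral_const_mul, integral_indicator_const _ hUm, ← hD, ← hpdef] at h
    simp at h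
    nlinarith
  have hLp : 1 / 8 ≤ (stdGaussian n).real L := by
    have hi : Integrable (L.indicator fun _ => (1 : ℝ)) (stdGaussian n) :=
      (integrable_const 1).indicator hLm
    have hi2 : Integrable (fun x => L.indicator (fun _ => (1 : ℝ)) x + 1 / 4)
        (stdGaussian n) := hi.add (integrable_const _)
    have h := integral_mono (μ := stdGaussian n) (f := fun x => 1 - G x)
      (g := fun x => (L.indicator (fun _ => (1 : ℝ)) x + 1 / 4) +
        16 * (G x ^ 2 * (1 - G x) ^ 2)) ((integrable_const _).sub hGi)
      (hi2.add (hki.const_mul 16)) fun x => by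
        obtain ⟨h0, h1⟩ := hG1 x
        by_cases hx : x ∈ L
        · simp only [Set.indicator_of_mem hx]
          nlinarith [sq_nonneg (G x * (1 - G x))]
        · simp only [Set.indicator_of_notMem hx]
          have hx' : 1 / 4 < G x := not_le.1 hx
          have h2 : 1 / 16 ≤ G x ^ 2 := by nlinarith
          nlinarith [mul_le_mul_of_nonneg_right h2 (sq_nonneg (1 - G x)),
            sq_nonneg (1 - G x - 1 / 2)]
    rw [integral_add hi2 (hki.const_mul 16),
      integral_add hi (integrable_const _), integral_sub (integrable_const _) hGi,
      integral_const_mul, integral_indicator_const _ hLm, ← hD, ← hpdef] at h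
    simp at h
    nlinarith
  have hlow : ENNReal.ofReal (1 / 40) * (stdGaussian n L * stdGaussian n U) ≤
      ∫⁻ q, ‖quinticRamp (G q.2) - quinticRamp (G q.1)‖ₑ
        ∂((stdGaussian n).prod (stdGaussian n)) := by
    rw [← Measure.prod_prod, ← setLIntegral_const]
    refine (setLIntegral_mono' (hLm.prod hUm) fun q hq => ?_).trans (setLIntegral_le_lintegral _ _)
    rw [← ofReal_norm]
    exact ENNReal.ofReal_le_ofReal ((le_quinticRamp_sub hq.1 hq.2).trans (le_abs_self _))
  have hup := hlow.trans (lintegral_enorm_quinticRamp_sub_le hf hf1 hβ hσ)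
  rw [← ofReal_integral_eq_lintegral_ofReal hki (ae_of_all _ fun x => by positivity), ← hD,
    ← ENNReal.ofReal_mul (by positivity), ← ENNReal.ofReal_mul (by positivity),
    ← ofReal_measureReal, ← ofReal_measureReal, ← ENNReal.ofReal_mul (by positivity),
    ← ENNReal.ofReal_mul (by positivity), ENNReal.ofReal_le_ofReal_iff] at hup
  · have h := mul_le_mul hLp hUp (by positivity) (by positivity)
    nlinarith
  · have : 0 ≤ D := hD ▸ integral_nonneg fun x => by positivity
    positivity

end GaussAvg

/-- anti-concentration of smoothed functions away from indicators. -/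
theorem stmt16 :
    ∃ c : ℝ, 0 < c ∧ ∀ (n : ℕ) (f : (Fin n → ℝ) → ℝ), Measurable f →
      (∀ x, f x ∈ Set.Icc (0 : ℝ) 1) →
      (∫ x, f x ∂(stdGaussian n)) ≤ 1 / 2 →
      ∀ s : ℝ, 0 < s → ∀ B : Set (Fin n → ℝ), MeasurableSet B →
        c * min ((∫ x, f x ∂(stdGaussian n)) ^ 2) (Real.sqrt s) *
            (∫ x, f x ∂(stdGaussian n))
          ≤ ∫ x, (OU n s f x - Set.indicator B (fun _ => (1 : ℝ)) x) ^ 2 ∂(stdGaussian n) := by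
  refine ⟨1 / 2560, by norm_num, fun n f hf hf1 hfp s hs B hB => ?_⟩
  set β := exp (-s) with hβ
  set σ := √(1 - exp (-2 * s)) with hσ
  have hβσ : exp (-2 * s) = β ^ 2 := by rw [hβ, ← exp_nat_mul]; congr 1; push_cast; ring
  have hβ0 : 0 < β := exp_pos _
  have hβ1 : β < 1 := exp_lt_one_iff.2 (by linarith)
  have hσ0 : 0 < σ := sqrt_pos.2 (by rw [hβσ]; nlinarith)
  have hOU : OU n s f = gaussAvg β σ f := rfl
  have hmean := integral_gaussAvg (n := n) (σ := σ) hf hf1 hβ0.le hβ1.le (by rw [hσ, hβσ])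
  rw [hOU, ← hmean]
  rw [← hmean] at hfp
  have hGm : Measurable (gaussAvg β σ f) := measurable_gaussAvg hf
  have hG1 (x) : gaussAvg β σ f x ∈ Set.Icc (0 : ℝ) 1 := gaussAvg_mem_Icc hf hf1 x
  have hk := le_integral_gaussAvg_sq_mul_sq hf hf1 hβ0.le hσ0 hfp rfl
  set G := gaussAvg β σ f with hG
  set p := ∫ x, G x ∂(stdGaussian n) with hp
  set D := ∫ x, G x ^ 2 * (1 - G x) ^ 2 ∂(stdGaussian n) with hD
  have hp0 : 0 ≤ p := integral_nonneg fun x => (hG1 x).1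
  have hD0 : 0 ≤ D := integral_nonneg fun x => by positivity
  have hDle : D ≤ ∫ x, (G x - Set.indicator B (fun _ => (1 : ℝ)) x) ^ 2 ∂(stdGaussian n) := by
    refine integral_mono_of_nonneg (ae_of_all _ fun x => by positivity) ?_
      (ae_of_all _ fun x => ?_)
    · refine Integrable.of_mem_Icc 0 1 ((hGm.sub (measurable_const.indicator hB)).pow_const
        2).aemeasurable (ae_of_all _ fun x => ⟨by positivity, ?_⟩)
      obtain ⟨h0, h1⟩ := hG1 x
      by_cases hx : x ∈ B
      · rw [Set.indicator_of_mem hx]; nlinarith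
      · rw [Set.indicator_of_notMem hx]; nlinarith
    · obtain ⟨h0, h1⟩ := hG1 x
      by_cases hx : x ∈ B
      · simp only [Set.indicator_of_mem hx]
        have h2 : G x ^ 2 ≤ 1 := pow_le_one₀ h0 h1
        nlinarith [sq_nonneg (1 - G x)]
      · simp only [Set.indicator_of_notMem hx]
        have h2 : (1 - G x) ^ 2 ≤ 1 := pow_le_one₀ (by linarith) (by linarith)
        nlinarith [sq_nonneg (G x)]
  refine le_trans ?_ hDle
  have hratio : β / σ * √s ≤ 1 := by
    rw [div_mul_eq_mul_div, div_le_one hσ0, hσ]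
    refine le_sqrt_of_sq_le ?_
    rw [mul_pow, sq_sqrt hs.le, hβσ]
    have h1 : β * exp s = 1 := by rw [hβ, ← exp_add]; simp
    have h2 := add_one_le_exp s
    nlinarith [mul_le_mul_of_nonneg_left h2 hβ0.le, mul_le_mul_of_nonneg_left h2 (sq_nonneg β)]
  by_cases hD1 : D < p ^ 2 / 32
  · have h1 := mul_le_mul_of_nonneg_right (hk hD1) (sqrt_nonneg s)
    have h2 : 640 * π * (β / σ * D) * √s ≤ 2560 * D := by
      calc _ = 640 * π * D * (β / σ * √s) := by ring
        _ ≤ 640 * π * D * 1 := by gcongr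
        _ ≤ 640 * 4 * D * 1 := by gcongr; exact pi_le_four
        _ = _ := by ring
    have h3 := mul_le_mul_of_nonneg_right (min_le_right (p ^ 2) (√s)) hp0
    nlinarith
  · have h3 := mul_le_mul_of_nonneg_right (min_le_left (p ^ 2) (√s)) hp0
    nlinarith [sq_nonneg p]
end
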